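/- arXiv:2009.09522 — 11 statements merged into one kernel-verified Lean document; each statement's English description precedes it below -/
import Mathlib

section
/- Let P be a metric space with exactly 4 points that satisfies the CAT(0) comparison. Then there exist a geodesic metric space X satisfying the CAT(0) comparison and a distance-preserving map from P into X. -/
/-- The quadruple `(p,q,x,y)` satisfies the CAT(0) (2+2) comparison with respect to the
distance function `d`: there is a model configuration `p', q', x', y'` in the Euclidean
plane realizing the five distances `d x y`, `d p x`, `d p y`, `d q x`, `d q y`, with `p'`
and `q'` on opposite sides of (or on) the line through `x'` and `y'`, such that
`d p q ≤ dist p' z + dist z q'` for every `z` on the segment `[x', y']`. -/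
def Cat0Quad {X : Type*} (d : X → X → ℝ) (p q x y : X) : Prop :=
  ∃ p' q' x' y' : EuclideanSpace ℝ (Fin 2),
    dist x' y' = d x y ∧
    dist p' x' = d p x ∧ dist p' y' = d p y ∧
    dist q' x' = d q x ∧ dist q' y' = d q y ∧
    ((y' 0 - x' 0) * (p' 1 - x' 1) - (y' 1 - x' 1) * (p' 0 - x' 0)) *
      ((y' 0 - x' 0) * (q' 1 - x' 1) - (y' 1 - x' 1) * (q' 0 - x' 0)) ≤ 0 ∧
    ∀ z ∈ segment ℝ x' y', d p q ≤ dist p' z + dist z q'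

/-- A metric space satisfies the CAT(0) comparison if every quadruple of its points,
in every labeling, satisfies the CAT(0) (2+2) comparison. -/
def Cat0Comparison (X : Type*) [MetricSpace X] : Prop :=
  ∀ p q x y : X, Cat0Quad (fun a b => dist a b) p q x y

/-- A metric space is geodesic if any two points `x`, `y` are joined by an isometric
embedding of the interval `[0, dist x y]`. -/
def IsGeodesicSpace (X : Type*) [MetricSpace X] : Prop :=
  ∀ x y : X, ∃ γ : ℝ → X, γ 0 = x ∧ γ (dist x y) = y ∧
    ∀ s ∈ Set.Icc (0 : ℝ) (dist x y), ∀ t ∈ Set.Icc (0 : ℝ) (dist x y),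
      dist (γ s) (γ t) = |s - t|

/-- Any two points are joined by a constant-speed geodesic along which the squared distance to
any third point is bounded by its Euclidean counterpart. -/
def HasComparisonGeodesics (X : Type*) [MetricSpace X] : Prop :=
  ∀ x y : X, ∃ γ : ℝ → X, γ 0 = x ∧ γ 1 = y ∧
    (∀ s t : ℝ, dist (γ s) (γ t) = |s - t| * dist x y) ∧
    ∀ p : X, ∀ t ∈ Set.Icc (0 : ℝ) 1,
      dist p (γ t) ^ 2 ≤
        (1 - t) * dist p x ^ 2 + t * dist p y ^ 2 - t * (1 - t) * dist x y ^ 2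

theorem HasComparisonGeodesics.isGeodesicSpace {X : Type*} [MetricSpace X]
    (hX : HasComparisonGeodesics X) : IsGeodesicSpace X := by
  intro x y
  obtain ⟨γ, h0, h1, hγ, -⟩ := hX x y
  rcases eq_or_ne (dist x y) 0 with h | h
  · refine ⟨fun _ => x, rfl, dist_eq_zero.1 h, ?_⟩
    intro s hs t ht
    rw [h] at hs ht
    have hs' : s = 0 := le_antisymm hs.2 hs.1
    have ht' : t = 0 := le_antisymm ht.2 ht.1
    simp [hs', ht']
  · refine ⟨fun s => γ (s / dist x y), by simp [h0], by simp [h, h1], ?_⟩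
    intro s _ t _
    rw [hγ, ← sub_div, abs_div, abs_of_nonneg (dist_nonneg (x := x) (y := y)),
      div_mul_cancel₀ _ h]

/-- A Euclidean triangle with prescribed side lengths, with base on the first coordinate axis. -/
theorem exists_triangle_apex {d a b : ℝ} (hd : 0 ≤ d) (ha : 0 ≤ a) (hb : 0 ≤ b)
    (h₁ : d ≤ a + b) (h₂ : a ≤ d + b) (h₃ : b ≤ d + a) :
    ∃ u h : ℝ, 0 ≤ h ∧ u ^ 2 + h ^ 2 = a ^ 2 ∧ (u - d) ^ 2 + h ^ 2 = b ^ 2 := by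
  rcases hd.eq_or_lt with rfl | hd
  · have : a = b := by linarith
    exact ⟨a, 0, le_rfl, by ring, by rw [this]; ring⟩
  · have hu : 2 * d * ((a ^ 2 + d ^ 2 - b ^ 2) / (2 * d)) = a ^ 2 + d ^ 2 - b ^ 2 := by
      field_simp
    set u := (a ^ 2 + d ^ 2 - b ^ 2) / (2 * d)
    have hlo : -a ≤ u := by
      by_contra! hlt
      nlinarith [mul_nonneg (sub_nonneg.2 h₃) (add_nonneg (add_nonneg hd.le ha) hb)]
    have hhi : u ≤ a := by
      by_contra! hlt
      nlinarith [mul_nonneg (sub_nonneg.2 h₁) (sub_nonneg.2 h₂)]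
    have hnn : 0 ≤ a ^ 2 - u ^ 2 := by nlinarith
    refine ⟨u, √(a ^ 2 - u ^ 2), Real.sqrt_nonneg _, ?_, ?_⟩ <;> rw [Real.sq_sqrt hnn]
    · ring
    · linear_combination -hu

theorem EuclideanSpace.dist_sq_fin_two (p q : EuclideanSpace ℝ (Fin 2)) :
    dist p q ^ 2 = (p 0 - q 0) ^ 2 + (p 1 - q 1) ^ 2 := by
  rw [EuclideanSpace.dist_eq, Real.sq_sqrt (by positivity), Fin.sum_univ_two, Real.dist_eq,
    Real.dist_eq, sq_abs, sq_abs]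

theorem HasComparisonGeodesics.cat0Comparison {X : Type*} [MetricSpace X]
    (hX : HasComparisonGeodesics X) : Cat0Comparison X := by
  intro p q x y
  obtain ⟨γ, -, -, -, hcmp⟩ := hX x y
  have apex (r : X) : ∃ u h : ℝ, 0 ≤ h ∧ u ^ 2 + h ^ 2 = dist r x ^ 2 ∧
      (u - dist x y) ^ 2 + h ^ 2 = dist r y ^ 2 := by
    refine exists_triangle_apex dist_nonneg dist_nonneg dist_nonneg ?_ ?_ ?_
    · exact dist_triangle_left x y r
    · rw [add_comm]; exact dist_triangle_right r x y
    · rw [add_comm]; exact dist_triangle r x y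
  obtain ⟨u, h, hh, hpx, hpy⟩ := apex p
  obtain ⟨v, k, hk, hqx, hqy⟩ := apex q
  have key {r s : EuclideanSpace ℝ (Fin 2)} {c : ℝ} (hc : 0 ≤ c)
      (hrs : (r 0 - s 0) ^ 2 + (r 1 - s 1) ^ 2 = c ^ 2) : dist r s = c := by
    rw [← EuclideanSpace.dist_sq_fin_two] at hrs
    exact (pow_left_inj₀ dist_nonneg hc two_ne_zero).1 hrs
  refine ⟨!₂[u, h], !₂[v, -k], !₂[0, 0], !₂[dist x y, 0],
    key dist_nonneg ?_, key dist_nonneg ?_, key dist_nonneg ?_, key dist_nonneg ?_,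
    key dist_nonneg ?_, ?_, ?_⟩
  · simp
  · simpa using hpx
  · simpa using hpy
  · simpa using hqx
  · simpa using hqy
  · have := mul_nonneg (mul_nonneg (dist_nonneg (x := x) (y := y)) hh)
      (mul_nonneg (dist_nonneg (x := x) (y := y)) hk)
    simp
    nlinarith
  · intro z hz
    rw [segment_eq_image] at hz
    obtain ⟨t, ht, rfl⟩ := hz
    refine (dist_triangle p (γ t) q).trans (add_le_add ?_ ?_)
    · refine (pow_le_pow_iff_left₀ dist_nonneg dist_nonneg two_ne_zero).1 ((hcmp p t ht).trans ?_)
      rw [EuclideanSpace.dist_sq_fin_two, ← hpx, ← hpy]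
      simp
      nlinarith
    · rw [dist_comm (γ t), dist_comm _ !₂[v, -k]]
      refine (pow_le_pow_iff_left₀ dist_nonneg dist_nonneg two_ne_zero).1 ((hcmp q t ht).trans ?_)
      rw [EuclideanSpace.dist_sq_fin_two, ← hqx, ← hqy]
      simp
      nlinarith

theorem hasComparisonGeodesics_euclideanSpace (ι : Type*) [Fintype ι] :
    HasComparisonGeodesics (EuclideanSpace ℝ ι) := by
  intro x y
  refine ⟨fun t => AffineMap.lineMap x y t, by simp, by simp, ?_, ?_⟩
  · intro s t
    rw [dist_lineMap_lineMap, Real.dist_eq]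
  · intro p t _
    have h₁ : p - AffineMap.lineMap x y t = (1 - t) • (p - x) + t • (p - y) := by
      rw [AffineMap.lineMap_apply_module]; module
    have h₂ : x - y = (p - y) - (p - x) := by abel
    simp only [dist_eq_norm]
    rw [h₁, h₂]
    generalize p - x = a, p - y = b
    rw [norm_add_sq_real, norm_sub_sq_real, norm_smul, norm_smul, mul_pow, mul_pow,
      real_inner_smul_left, real_inner_smul_right, real_inner_comm a b, Real.norm_eq_abs,
      Real.norm_eq_abs, sq_abs, sq_abs]
    linarith

theorem WithLp.prod_dist_sq {X Y : Type*} [MetricSpace X] [MetricSpace Y]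
    (a b : WithLp 2 (X × Y)) : dist a b ^ 2 = dist a.fst b.fst ^ 2 + dist a.snd b.snd ^ 2 := by
  rw [WithLp.prod_dist_eq_add (by norm_num)]
  norm_num
  rw [← Real.sqrt_eq_rpow, Real.sq_sqrt (by positivity)]

theorem HasComparisonGeodesics.prod {X Y : Type*} [MetricSpace X] [MetricSpace Y]
    (hX : HasComparisonGeodesics X) (hY : HasComparisonGeodesics Y) :
    HasComparisonGeodesics (WithLp 2 (X × Y)) := by
  intro x y
  obtain ⟨γ, h0, h1, hγ, hγ'⟩ := hX x.fst y.fst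
  obtain ⟨δ, k0, k1, hδ, hδ'⟩ := hY x.snd y.snd
  refine ⟨fun t => WithLp.toLp 2 (γ t, δ t), ?_, ?_, ?_, ?_⟩
  · simp only [h0, k0]; rfl
  · simp only [h1, k1]; rfl
  · intro s t
    refine (pow_left_inj₀ dist_nonneg (by positivity) two_ne_zero).1 ?_
    rw [mul_pow, WithLp.prod_dist_sq, WithLp.prod_dist_sq]
    change dist (γ s) (γ t) ^ 2 + dist (δ s) (δ t) ^ 2 = _
    rw [hγ, hδ]
    ring
  · intro p t ht
    simp only [WithLp.prod_dist_sq]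
    change dist p.fst (γ t) ^ 2 + dist p.snd (δ t) ^ 2 ≤ _
    linarith [hγ' p.fst t ht, hδ' p.snd t ht]

/-- Three half-lines glued at their origins, with the length metric. -/
abbrev Tripod : Type :=
  {v : PiLp 1 (fun _ : Fin 3 => ℝ) //
    ∃ k : Fin 3, ∃ c : ℝ, 0 ≤ c ∧ v = WithLp.toLp 1 (Pi.single k c)}

namespace Tripod

/-- The point at distance `c` from the centre on the leg `k`. -/
def leg (k : Fin 3) (c : ℝ) (hc : 0 ≤ c) : Tripod :=
  ⟨WithLp.toLp 1 (Pi.single k c), k, c, hc, rfl⟩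

theorem exists_eq_leg (p : Tripod) : ∃ k c hc, p = leg k c hc := by
  obtain ⟨_, k, c, hc, rfl⟩ := p
  exact ⟨k, c, hc, rfl⟩

theorem dist_leg_self (k : Fin 3) {a b : ℝ} (ha : 0 ≤ a) (hb : 0 ≤ b) :
    dist (leg k a ha) (leg k b hb) = |a - b| := by
  rw [Subtype.dist_eq, PiLp.dist_eq_of_L1, Fin.sum_univ_three]
  fin_cases k <;> simp [leg, Real.dist_eq]

theorem dist_leg_of_ne {k l : Fin 3} (hkl : k ≠ l) {a b : ℝ} (ha : 0 ≤ a) (hb : 0 ≤ b) :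
    dist (leg k a ha) (leg l b hb) = a + b := by
  rw [Subtype.dist_eq, PiLp.dist_eq_of_L1, Fin.sum_univ_three]
  fin_cases k <;> fin_cases l <;>
    simp [leg, Real.dist_eq, abs_of_nonneg ha, abs_of_nonneg hb, add_comm] at hkl ⊢

/-- The line made of the legs `k` and `l`. -/
noncomputable def line (k l : Fin 3) (u : ℝ) : Tripod :=
  if h : 0 ≤ u then leg k u h else leg l (-u) (by linarith)

theorem line_of_nonneg (k l : Fin 3) {u : ℝ} (h : 0 ≤ u) : line k l u = leg k u h := dif_pos h

theorem line_neg {k l : Fin 3} {u : ℝ} (h : 0 ≤ u) : line k l (-u) = leg l u h := by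
  rcases h.eq_or_lt with rfl | hu
  · rw [neg_zero, line_of_nonneg k l le_rfl]
    ext i
    simp [leg]
  · simp [line, not_le.2 hu]

theorem dist_line_line {k l : Fin 3} (hkl : k ≠ l) (u v : ℝ) :
    dist (line k l u) (line k l v) = |u - v| := by
  unfold line
  split_ifs with hu hv hv
  · exact dist_leg_self ..
  · rw [dist_leg_of_ne hkl, abs_of_nonneg] <;> linarith
  · rw [dist_leg_of_ne hkl.symm, abs_of_nonpos] <;> linarith
  · rw [dist_leg_self, ← abs_neg]; congr 1; ring

theorem dist_leg_line {k l m : Fin 3} (hk : m ≠ k) (hl : m ≠ l) {c : ℝ} (hc : 0 ≤ c) (u : ℝ) :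
    dist (leg m c hc) (line k l u) = c + |u| := by
  unfold line
  split_ifs with hu
  · rw [dist_leg_of_ne hk, abs_of_nonneg hu]
  · rw [dist_leg_of_ne hl, abs_of_neg (not_le.1 hu)]

theorem exists_eq_line (x y : Tripod) :
    ∃ k l, k ≠ l ∧ ∃ a b, x = line k l a ∧ y = line k l b := by
  obtain ⟨k, a, ha, rfl⟩ := exists_eq_leg x
  obtain ⟨l, b, hb, rfl⟩ := exists_eq_leg y
  rcases eq_or_ne k l with rfl | hkl
  · obtain ⟨l, hl⟩ := exists_ne k
    exact ⟨k, l, hl.symm, a, b, (line_of_nonneg _ _ ha).symm, (line_of_nonneg _ _ hb).symm⟩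
  · exact ⟨k, l, hkl, a, -b, (line_of_nonneg _ _ ha).symm, (line_neg hb).symm⟩

theorem hasComparisonGeodesics : HasComparisonGeodesics Tripod := by
  intro x y
  obtain ⟨k, l, hkl, a, b, rfl, rfl⟩ := exists_eq_line x y
  refine ⟨fun t => line k l ((1 - t) * a + t * b), by simp, by simp, ?_, ?_⟩
  · intro s t
    rw [dist_line_line hkl, dist_line_line hkl, ← abs_mul, ← abs_neg]
    congr 1; ring
  · rintro p t ⟨ht₀, ht₁⟩
    obtain ⟨m, c, hc, rfl⟩ := exists_eq_leg p
    by_cases hk : m = k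
    · subst hk
      rw [← line_of_nonneg m l hc]
      simp only [dist_line_line hkl, sq_abs]
      nlinarith
    by_cases hl : m = l
    · subst hl
      rw [← line_neg (k := k) hc]
      simp only [dist_line_line hkl, sq_abs]
      nlinarith
    · simp only [dist_line_line hkl, dist_leg_line hk hl, sq_abs, add_sq]
      have habs : |(1 - t) * a + t * b| ≤ (1 - t) * |a| + t * |b| := by
        refine (abs_add_le _ _).trans_eq ?_
        rw [abs_mul, abs_mul, abs_of_nonneg ht₀, abs_of_nonneg (sub_nonneg.2 ht₁)]
      nlinarith [mul_le_mul_of_nonneg_left habs hc]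

end Tripod

/-- Points covering a metric space are mapped isometrically as soon as the six distances agree. -/
theorem exists_isometry_of_four_points {P X : Type*} [MetricSpace P] [MetricSpace X]
    {p q x y : P} (hcover : ∀ t, t = p ∨ t = q ∨ t = x ∨ t = y) {p' q' x' y' : X}
    (hpq : dist p' q' ^ 2 = dist p q ^ 2) (hpx : dist p' x' ^ 2 = dist p x ^ 2)
    (hpy : dist p' y' ^ 2 = dist p y ^ 2) (hqx : dist q' x' ^ 2 = dist q x ^ 2)
    (hqy : dist q' y' ^ 2 = dist q y ^ 2) (hxy : dist x' y' ^ 2 = dist x y ^ 2) :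
    ∃ f : P → X, Isometry f := by
  simp only [pow_left_inj₀ dist_nonneg dist_nonneg two_ne_zero] at hpq hpx hpy hqx hqy hxy
  have key : ∀ t, ∃ t' : X, dist p' t' = dist p t ∧ dist q' t' = dist q t ∧
      dist x' t' = dist x t ∧ dist y' t' = dist y t := by
    intro t
    rcases hcover t with rfl | rfl | rfl | rfl
    · exact ⟨p', by simp, by rw [dist_comm, hpq, dist_comm], by rw [dist_comm, hpx, dist_comm],
        by rw [dist_comm, hpy, dist_comm]⟩
    · exact ⟨q', hpq, by simp, by rw [dist_comm, hqx, dist_comm],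
        by rw [dist_comm, hqy, dist_comm]⟩
    · exact ⟨x', hpx, hqx, by simp, by rw [dist_comm, hxy, dist_comm]⟩
    · exact ⟨y', hpy, hqy, hxy, by simp⟩
  choose f hf using key
  have hp : f p = p' := (dist_eq_zero.1 (by simpa using (hf p).1)).symm
  have hq : f q = q' := (dist_eq_zero.1 (by simpa using (hf q).2.1)).symm
  have hx : f x = x' := (dist_eq_zero.1 (by simpa using (hf x).2.2.1)).symm
  have hy : f y = y' := (dist_eq_zero.1 (by simpa using (hf y).2.2.2)).symm
  refine ⟨f, Isometry.of_dist_eq fun s t => ?_⟩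
  rcases hcover s with rfl | rfl | rfl | rfl
  · rw [hp, (hf t).1]
  · rw [hq, (hf t).2.1]
  · rw [hx, (hf t).2.2.1]
  · rw [hy, (hf t).2.2.2]

/-- The quadratic form `-∑ wᵢ wⱼ dᵢⱼ²` (sum over pairs) of a four-point configuration. -/
def quadForm {P : Type*} [MetricSpace P] (p q x y : P) (a b c e : ℝ) : ℝ :=
  -(a * b * dist p q ^ 2 + a * c * dist p x ^ 2 + a * e * dist p y ^ 2 +
    b * c * dist q x ^ 2 + b * e * dist q y ^ 2 + c * e * dist x y ^ 2)

/-- The cosine of the Euclidean comparison angle at `p`. -/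
noncomputable def cosAngle {P : Type*} [MetricSpace P] (p a b : P) : ℝ :=
  (dist p a ^ 2 + dist p b ^ 2 - dist a b ^ 2) / (2 * dist p a * dist p b)

section Comparison

variable {P : Type*} [MetricSpace P]

theorem dist_sq_eq_cosAngle {p a b : P} (ha : p ≠ a) (hb : p ≠ b) :
    dist a b ^ 2 = dist p a ^ 2 + dist p b ^ 2 - 2 * dist p a * dist p b * cosAngle p a b := by
  have ha' := (dist_pos.2 ha).ne'
  have hb' := (dist_pos.2 hb).ne'
  unfold cosAngle
  field_simp
  ring

theorem cosAngle_le_one {p a b : P} (ha : p ≠ a) (hb : p ≠ b) : cosAngle p a b ≤ 1 := by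
  have ha' := dist_pos.2 ha
  have hb' := dist_pos.2 hb
  rw [cosAngle, div_le_one (by positivity)]
  have h₁ := dist_triangle p a b
  have h₂ := dist_triangle_right p a b
  nlinarith [mul_nonneg (sub_nonneg.2 h₁) (sub_nonneg.2 h₂)]

theorem neg_one_le_cosAngle {p a b : P} (ha : p ≠ a) (hb : p ≠ b) : -1 ≤ cosAngle p a b := by
  have ha' := dist_pos.2 ha
  have hb' := dist_pos.2 hb
  rw [cosAngle, le_div_iff₀ (by positivity)]
  have h₁ := dist_triangle_left a b p
  nlinarith [dist_nonneg (x := a) (y := b)]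

theorem dist_leg_toLp_sq (k l : Fin 3) {a b : ℝ} (ha : 0 ≤ a) (hb : 0 ≤ b)
    (u₀ u₁ u₂ v₀ v₁ v₂ : ℝ) :
    dist (WithLp.toLp 2 (Tripod.leg k a ha, !₂[u₀, u₁, u₂]))
      (WithLp.toLp 2 (Tripod.leg l b hb, !₂[v₀, v₁, v₂])) ^ 2 =
      (if k = l then a - b else a + b) ^ 2 +
        ((u₀ - v₀) ^ 2 + (u₁ - v₁) ^ 2 + (u₂ - v₂) ^ 2) := by
  rw [WithLp.prod_dist_sq]
  change dist (Tripod.leg k a ha) (Tripod.leg l b hb) ^ 2 +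
    dist !₂[u₀, u₁, u₂] !₂[v₀, v₁, v₂] ^ 2 = _
  congr 1
  · split_ifs with h
    · rw [h, Tripod.dist_leg_self, sq_abs]
    · rw [Tripod.dist_leg_of_ne h]
  · rw [EuclideanSpace.dist_eq, Real.sq_sqrt (by positivity), Fin.sum_univ_three]
    simp [Real.dist_eq, sq_abs]

/-- If the comparison angles at `p` are so large that their cosines sum to at most `-1`, the four
points embed in the product of a tripod and Euclidean space. -/
theorem exists_isometry_of_cosAngle_sum_le {p a b c : P}
    (hcover : ∀ t, t = p ∨ t = a ∨ t = b ∨ t = c) (ha : p ≠ a) (hb : p ≠ b) (hc : p ≠ c)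
    (hsum : cosAngle p a b + cosAngle p a c + cosAngle p b c ≤ -1) :
    ∃ f : P → WithLp 2 (Tripod × EuclideanSpace ℝ (Fin 3)), Isometry f := by
  have hab := dist_sq_eq_cosAngle ha hb
  have hac := dist_sq_eq_cosAngle ha hc
  have hbc := dist_sq_eq_cosAngle hb hc
  have h₁ := neg_one_le_cosAngle ha hb
  have h₂ := neg_one_le_cosAngle ha hc
  have h₃ := neg_one_le_cosAngle hb hc
  have ra := dist_nonneg (x := p) (y := a)
  have rb := dist_nonneg (x := p) (y := b)
  have rc := dist_nonneg (x := p) (y := c)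
  generalize cosAngle p a b = α at *
  generalize cosAngle p a c = β at *
  generalize cosAngle p b c = δ at *
  have s₀ : √(-(1 + α + β + δ) / 2) ^ 2 = -(1 + α + β + δ) / 2 := Real.sq_sqrt (by linarith)
  have s₁ : √((1 + α) / 2) ^ 2 = (1 + α) / 2 := Real.sq_sqrt (by linarith)
  have s₂ : √((1 + β) / 2) ^ 2 = (1 + β) / 2 := Real.sq_sqrt (by linarith)
  have s₃ : √((1 + δ) / 2) ^ 2 = (1 + δ) / 2 := Real.sq_sqrt (by linarith)
  have n₀ : 0 ≤ √(-(1 + α + β + δ) / 2) := Real.sqrt_nonneg _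
  generalize √(-(1 + α + β + δ) / 2) = w₀ at *
  generalize √((1 + α) / 2) = w₁ at *
  generalize √((1 + β) / 2) = w₂ at *
  generalize √((1 + δ) / 2) = w₃ at *
  refine exists_isometry_of_four_points hcover
    (p' := WithLp.toLp 2 (Tripod.leg 0 0 le_rfl, !₂[0, 0, 0]))
    (q' := WithLp.toLp 2 (Tripod.leg 0 (w₀ * dist p a) (by positivity),
      !₂[w₁ * dist p a, w₂ * dist p a, -(w₃ * dist p a)]))
    (x' := WithLp.toLp 2 (Tripod.leg 1 (w₀ * dist p b) (by positivity),
      !₂[w₁ * dist p b, -(w₂ * dist p b), w₃ * dist p b]))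
    (y' := WithLp.toLp 2 (Tripod.leg 2 (w₀ * dist p c) (by positivity),
      !₂[-(w₁ * dist p c), w₂ * dist p c, w₃ * dist p c]))
    ?_ ?_ ?_ ?_ ?_ ?_ <;> rw [dist_leg_toLp_sq]
  · rw [if_pos rfl]
    linear_combination dist p a ^ 2 * (s₀ + s₁ + s₂ + s₃)
  · rw [if_neg (by decide)]
    linear_combination dist p b ^ 2 * (s₀ + s₁ + s₂ + s₃)
  · rw [if_neg (by decide)]
    linear_combination dist p c ^ 2 * (s₀ + s₁ + s₂ + s₃)
  · rw [if_neg (by decide), hab]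
    linear_combination (dist p a + dist p b) ^ 2 * (s₀ + s₂ + s₃) + (dist p a - dist p b) ^ 2 * s₁
  · rw [if_neg (by decide), hac]
    linear_combination (dist p a + dist p c) ^ 2 * (s₀ + s₁ + s₃) + (dist p a - dist p c) ^ 2 * s₂
  · rw [if_neg (by decide), hbc]
    linear_combination (dist p b + dist p c) ^ 2 * (s₀ + s₁ + s₂) + (dist p b - dist p c) ^ 2 * s₃

theorem quadForm_three_nonneg (p q x y : P) {a b c : ℝ} (h : a + b + c = 0) :
    0 ≤ quadForm p q x y a b c 0 := by
  obtain rfl : c = -(a + b) := by linarith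
  have h₁ := dist_triangle_left p q x
  have h₂ := dist_triangle p q x
  have h₃ := dist_triangle q p x
  have hsq : quadForm p q x y a b (-(a + b)) 0 = a ^ 2 * dist p x ^ 2 + b ^ 2 * dist q x ^ 2 +
      a * b * (dist p x ^ 2 + dist q x ^ 2 - dist p q ^ 2) := by
    unfold quadForm; ring
  rw [hsq]
  rw [dist_comm x p, dist_comm x q] at h₁
  rw [dist_comm q p] at h₃
  have hpq := dist_nonneg (x := p) (y := q)
  have hpx := dist_nonneg (x := p) (y := x)
  have hqx := dist_nonneg (x := q) (y := x)
  rcases le_total 0 (a * b) with hab | hab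
  · have : 0 ≤ a * b * ((dist p x + dist q x) ^ 2 - dist p q ^ 2) :=
      mul_nonneg hab (by nlinarith)
    nlinarith [sq_nonneg (a * dist p x - b * dist q x)]
  · have : 0 ≤ -(a * b) * (dist p q ^ 2 - (dist p x - dist q x) ^ 2) :=
      mul_nonneg (by linarith) (by nlinarith)
    nlinarith [sq_nonneg (a * dist p x + b * dist q x)]

theorem gram_three_nonneg_of_corner {A B C α β δ : ℝ} (hA : 0 < A) (hB : 0 < B) (hC : 0 < C)
    (hα : -1 ≤ α) (hβ : β ≤ 1) (hδ : δ ≤ 1) (h : 1 + α - β - δ < 0) :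
    0 ≤ A ^ 2 + B ^ 2 + C ^ 2 + 2 * α * (A * B) + 2 * β * (A * C) + 2 * δ * (B * C) := by
  have hAC := mul_pos hA hC
  have hBC := mul_pos hB hC
  nlinarith [mul_nonneg (by linarith : 0 ≤ 1 + α) (sq_nonneg (A + B + C)),
    mul_nonneg (by linarith : 0 ≤ 1 - β) (sq_nonneg (A - B - C)),
    mul_nonneg (by linarith : 0 ≤ 1 - δ) (sq_nonneg (A - B + C)),
    mul_nonneg (by linarith : 0 ≤ -(1 + α - β - δ)) (sq_nonneg (A - B + C)),
    mul_nonneg (by linarith : 0 ≤ -(1 + α - β - δ)) hBC.le,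
    mul_nonneg (by linarith : 0 ≤ -(1 + α - β - δ)) hAC.le]

theorem gram_three_nonneg {A B C α β δ : ℝ} (hA : 0 < A) (hB : 0 < B) (hC : 0 < C)
    (hα₁ : α ≤ 1) (hα : -1 ≤ α) (hβ₁ : β ≤ 1) (hβ : -1 ≤ β) (hδ₁ : δ ≤ 1) (hδ : -1 ≤ δ)
    (h : -1 < α + β + δ) :
    0 ≤ A ^ 2 + B ^ 2 + C ^ 2 + 2 * α * (A * B) + 2 * β * (A * C) + 2 * δ * (B * C) := by
  by_cases k₁ : 1 + α - β - δ < 0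
  · exact gram_three_nonneg_of_corner hA hB hC hα hβ₁ hδ₁ k₁
  by_cases k₂ : 1 - α + β - δ < 0
  · linarith [gram_three_nonneg_of_corner hA hC hB hβ hα₁ hδ₁ (by linarith)]
  by_cases k₃ : 1 - α - β + δ < 0
  · linarith [gram_three_nonneg_of_corner hC hB hA hδ hβ₁ hα₁ (by linarith)]
  linarith [mul_nonneg (by linarith : 0 ≤ 1 + α + β + δ) (sq_nonneg (A + B + C)),
    mul_nonneg (not_lt.1 k₁) (sq_nonneg (A + B - C)),
    mul_nonneg (not_lt.1 k₂) (sq_nonneg (A - B + C)),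
    mul_nonneg (not_lt.1 k₃) (sq_nonneg (A - B - C))]

theorem quadForm_nonneg_of_lt_cosAngle_sum {p a b c : P} (ha : p ≠ a) (hb : p ≠ b) (hc : p ≠ c)
    (hsum : -1 < cosAngle p a b + cosAngle p a c + cosAngle p b c) {w u v z : ℝ}
    (hw : w + u + v + z = 0) (hu : 0 < u) (hv : 0 < v) (hz : 0 < z) :
    0 ≤ quadForm p a b c w u v z := by
  have hq : quadForm p a b c w u v z = (u * dist p a) ^ 2 + (v * dist p b) ^ 2 +
      (z * dist p c) ^ 2 + 2 * cosAngle p a b * (u * dist p a * (v * dist p b)) +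
      2 * cosAngle p a c * (u * dist p a * (z * dist p c)) +
      2 * cosAngle p b c * (v * dist p b * (z * dist p c)) := by
    obtain rfl : w = -(u + v + z) := by linarith
    unfold quadForm
    rw [dist_sq_eq_cosAngle ha hb, dist_sq_eq_cosAngle ha hc, dist_sq_eq_cosAngle hb hc]
    ring
  rw [hq]
  exact gram_three_nonneg (mul_pos hu (dist_pos.2 ha)) (mul_pos hv (dist_pos.2 hb))
    (mul_pos hz (dist_pos.2 hc)) (cosAngle_le_one ha hb) (neg_one_le_cosAngle ha hb)
    (cosAngle_le_one ha hc) (neg_one_le_cosAngle ha hc) (cosAngle_le_one hb hc)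
    (neg_one_le_cosAngle hb hc) hsum

/-- A segment between points on opposite sides of a line in the plane meets the line. -/
theorem exists_segment_crossing_line {p q x y : EuclideanSpace ℝ (Fin 2)} (hxy : x ≠ y)
    (hside : ((y 0 - x 0) * (p 1 - x 1) - (y 1 - x 1) * (p 0 - x 0)) *
      ((y 0 - x 0) * (q 1 - x 1) - (y 1 - x 1) * (q 0 - x 0)) ≤ 0) :
    ∃ τ ∈ Set.Icc (0 : ℝ) 1, ∃ μ : ℝ,
      (1 - τ) * p 0 + τ * q 0 = (1 - μ) * x 0 + μ * y 0 ∧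
      (1 - τ) * p 1 + τ * q 1 = (1 - μ) * x 1 + μ * y 1 := by
  have hpos : 0 < (y 0 - x 0) ^ 2 + (y 1 - x 1) ^ 2 := by
    have := pow_pos (dist_pos.2 hxy.symm) 2
    rwa [EuclideanSpace.dist_sq_fin_two] at this
  obtain ⟨τ, hτ, hcross⟩ : ∃ τ ∈ Set.Icc (0 : ℝ) 1,
      (1 - τ) * ((y 0 - x 0) * (p 1 - x 1) - (y 1 - x 1) * (p 0 - x 0)) +
      τ * ((y 0 - x 0) * (q 1 - x 1) - (y 1 - x 1) * (q 0 - x 0)) = 0 := by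
    generalize (y 0 - x 0) * (p 1 - x 1) - (y 1 - x 1) * (p 0 - x 0) = r at *
    generalize (y 0 - x 0) * (q 1 - x 1) - (y 1 - x 1) * (q 0 - x 0) = s at *
    rcases eq_or_ne r s with rfl | hrs
    · have : r = 0 := by nlinarith
      exact ⟨0, by simp, by simp [this]⟩
    · have hrs' : r - s ≠ 0 := sub_ne_zero.2 hrs
      have h₁ : r / (r - s) = r ^ 2 * (r - s)⁻¹ ^ 2 + -(r * s) * (r - s)⁻¹ ^ 2 := by
        field_simp
        ring
      have h₂ : 1 - r / (r - s) = s ^ 2 * (r - s)⁻¹ ^ 2 + -(r * s) * (r - s)⁻¹ ^ 2 := by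
        field_simp
        ring
      have h₃ : 0 ≤ -(r * s) := by linarith
      refine ⟨r / (r - s), ⟨?_, ?_⟩, ?_⟩
      · rw [h₁]; positivity
      · rw [← sub_nonneg, h₂]; positivity
      · field_simp
        ring
  set z₀ := (1 - τ) * p 0 + τ * q 0
  set z₁ := (1 - τ) * p 1 + τ * q 1
  have hz : (y 0 - x 0) * (z₁ - x 1) - (y 1 - x 1) * (z₀ - x 0) = 0 := by
    linear_combination hcross
  refine ⟨τ, hτ, ((z₀ - x 0) * (y 0 - x 0) + (z₁ - x 1) * (y 1 - x 1)) /
    ((y 0 - x 0) ^ 2 + (y 1 - x 1) ^ 2), ?_, ?_⟩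
  · field_simp
    linear_combination -(y 1 - x 1) * hz
  · field_simp
    linear_combination (y 0 - x 0) * hz

/-- If the form is nonpositive at `u` and negative at `v`, it is negative at one of
`u + s v`, `u - t v`. -/
theorem quadForm_neg_or_neg {p q x y : P} {a b c e a' b' c' e' s t : ℝ} (hs : 0 < s) (ht : 0 < t)
    (hu : quadForm p q x y a b c e ≤ 0) (hv : quadForm p q x y a' b' c' e' < 0) :
    quadForm p q x y (a + s * a') (b + s * b') (c + s * c') (e + s * e') < 0 ∨
      quadForm p q x y (a - t * a') (b - t * b') (c - t * c') (e - t * e') < 0 := by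
  by_contra! h
  have key : t * quadForm p q x y (a + s * a') (b + s * b') (c + s * c') (e + s * e') +
      s * quadForm p q x y (a - t * a') (b - t * b') (c - t * c') (e - t * e') =
      (s + t) * quadForm p q x y a b c e + s * t * (s + t) * quadForm p q x y a' b' c' e' := by
    unfold quadForm; ring
  nlinarith [mul_nonneg ht.le h.1, mul_nonneg hs.le h.2,
    mul_neg_of_pos_of_neg (by positivity : 0 < s * t * (s + t)) hv,
    mul_nonpos_of_nonneg_of_nonpos (by positivity : 0 ≤ s + t) hu]

theorem quadForm_swap_last (p q x y : P) (a b c e : ℝ) :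
    quadForm p q y x a b e c = quadForm p q x y a b c e := by
  rw [quadForm, quadForm, dist_comm y x]; ring

theorem quadForm_zero_third (p q x y : P) {a b e : ℝ} (h : a + b + e = 0) :
    0 ≤ quadForm p q x y a b 0 e := by
  rw [← quadForm_swap_last]; exact quadForm_three_nonneg _ _ _ _ h

/-- A nonpositive value at a vector of signs `(+, +, -, +)` excludes negative values at vectors
of signs `(+, +, -, -)`. -/
theorem quadForm_nonneg_of_face_nonpos {p q x y : P} {α β γ a b c e : ℝ} (hγ : 0 < γ)
    (hu : quadForm p q x y α β (-1) γ ≤ 0) (hsum : α + β + γ = 1) (h : a + b + c + e = 0)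
    (hc : c < 0) (he : e < 0) : 0 ≤ quadForm p q x y a b c e := by
  by_contra! hv
  rcases quadForm_neg_or_neg (s := γ / -e) (t := 1 / -c) (div_pos hγ (by linarith))
    (div_pos one_pos (by linarith)) hu hv with h' | h'
  · have h₀ : γ + γ / -e * e = 0 := by field_simp [he.ne]; ring
    rw [h₀] at h'
    exact h'.not_ge (quadForm_three_nonneg _ _ _ _ (by
      linear_combination hsum - h₀ + γ / -e * h))
  · have h₀ : -1 - 1 / -c * c = 0 := by field_simp [hc.ne]; ring
    rw [h₀] at h'
    exact h'.not_ge (quadForm_zero_third _ _ _ _ (by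
      linear_combination hsum - h₀ - 1 / -c * h))

theorem quadForm_eq_sq_fin_two (p q x y : EuclideanSpace ℝ (Fin 2)) {a b c e : ℝ}
    (h : a + b + c + e = 0) : quadForm p q x y a b c e =
      (a * p 0 + b * q 0 + c * x 0 + e * y 0) ^ 2 +
        (a * p 1 + b * q 1 + c * x 1 + e * y 1) ^ 2 := by
  obtain rfl : e = -(a + b + c) := by linarith
  simp only [quadForm, EuclideanSpace.dist_sq_fin_two]
  ring

/-- The (2+2) comparison makes the form nonnegative at vectors of signs `(+, +, -, -)`. -/
theorem quadForm_nonneg_of_cat0Quad {p q x y : P} (hxy : x ≠ y)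
    (hcat : Cat0Quad (fun a b => dist a b) p q x y) {a b c e : ℝ} (h : a + b + c + e = 0)
    (ha : 0 < a) (hb : 0 < b) (hc : c < 0) (he : e < 0) :
    0 ≤ quadForm p q x y a b c e := by
  obtain ⟨p', q', x', y', hx'y', hp'x', hp'y', hq'x', hq'y', hside, hseg⟩ := hcat
  by_contra! hneg
  have hdiff (a b c e : ℝ) : quadForm p q x y a b c e =
      quadForm p' q' x' y' a b c e - a * b * (dist p q ^ 2 - dist p' q' ^ 2) := by
    simp only [quadForm, hx'y', hp'x', hp'y', hq'x', hq'y']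
    ring
  have hlt : 0 < dist p q ^ 2 - dist p' q' ^ 2 := by
    have h₁ := hdiff a b c e
    rw [quadForm_eq_sq_fin_two _ _ _ _ h] at h₁
    exact pos_of_mul_pos_right (a := a * b) (by nlinarith) (by positivity)
  have hflat {α β γ δ : ℝ} (hα : 0 ≤ α) (hβ : 0 ≤ β) (hs : α + β + γ + δ = 0)
      (h₀ : α * p' 0 + β * q' 0 + γ * x' 0 + δ * y' 0 = 0)
      (h₁ : α * p' 1 + β * q' 1 + γ * x' 1 + δ * y' 1 = 0) :
      quadForm p q x y α β γ δ ≤ 0 := by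
    rw [hdiff, quadForm_eq_sq_fin_two _ _ _ _ hs, h₀, h₁]
    nlinarith [mul_nonneg (mul_nonneg hα hβ) hlt.le]
  have hx'y'_ne : x' ≠ y' := by
    rw [← dist_pos, hx'y']; exact dist_pos.2 hxy
  obtain ⟨τ, ⟨hτ₀, hτ₁⟩, μ, hz₀, hz₁⟩ := exists_segment_crossing_line hx'y'_ne hside
  rcases lt_or_ge μ 0 with hμ | hμ
  · have hμ' : 0 < 1 - μ := by linarith
    refine hneg.not_ge (quadForm_nonneg_of_face_nonpos (α := (1 - τ) / (1 - μ)) (β := τ / (1 - μ))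
      (γ := -μ / (1 - μ)) (div_pos (by linarith) hμ') (hflat (div_nonneg (by linarith) hμ'.le)
        (div_nonneg hτ₀ hμ'.le) ?_ ?_ ?_) ?_ h hc he) <;> field_simp
    · ring
    · linear_combination hz₀
    · linear_combination hz₁
    · ring
  rcases lt_or_ge 1 μ with hμ₁ | hμ₁
  · have hμ' : 0 < μ := by linarith
    rw [← quadForm_swap_last] at hneg
    refine hneg.not_ge (quadForm_nonneg_of_face_nonpos (α := (1 - τ) / μ) (β := τ / μ)
      (γ := (μ - 1) / μ) (div_pos (by linarith) hμ') ?_ ?_ (by linarith) he hc)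
    · rw [quadForm_swap_last]
      refine hflat (div_nonneg (by linarith) hμ'.le) (div_nonneg hτ₀ hμ'.le) ?_ ?_ ?_ <;>
        field_simp
      · ring
      · linear_combination hz₀
      · linear_combination hz₁
    · field_simp
      ring
  · have hz : AffineMap.lineMap p' q' τ ∈ segment ℝ x' y' := by
      rw [segment_eq_image_lineMap]
      refine ⟨μ, ⟨hμ, hμ₁⟩, ?_⟩
      ext i
      fin_cases i
      · simpa [AffineMap.lineMap_apply_module] using hz₀.symm
      · simpa [AffineMap.lineMap_apply_module] using hz₁.symm
    have hle := hseg _ hz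
    rw [dist_left_lineMap, dist_lineMap_right, Real.norm_of_nonneg hτ₀,
      Real.norm_of_nonneg (sub_nonneg.2 hτ₁), ← add_mul, add_sub_cancel, one_mul] at hle
    nlinarith [dist_nonneg (x := p) (y := q)]

theorem quadForm_neg (p q x y : P) (a b c e : ℝ) :
    quadForm p q x y (-a) (-b) (-c) (-e) = quadForm p q x y a b c e := by
  unfold quadForm; ring

theorem quadForm_swap_first (p q x y : P) (a b c e : ℝ) :
    quadForm q p x y b a c e = quadForm p q x y a b c e := by
  rw [quadForm, quadForm, dist_comm q p]; ring

theorem quadForm_swap_middle (p q x y : P) (a b c e : ℝ) :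
    quadForm p x q y a c b e = quadForm p q x y a b c e := by
  rw [quadForm, quadForm, dist_comm x q]; ring

theorem quadForm_nonneg_of_pos (hP : Cat0Comparison P) {p q x y : P} (hpq : p ≠ q) (hpx : p ≠ x)
    (hpy : p ≠ y) (hqx : q ≠ x) (hqy : q ≠ y) (hxy : x ≠ y)
    (hp : -1 < cosAngle p q x + cosAngle p q y + cosAngle p x y)
    (hq : -1 < cosAngle q p x + cosAngle q p y + cosAngle q x y)
    (hx : -1 < cosAngle x p q + cosAngle x p y + cosAngle x q y)
    (hy : -1 < cosAngle y p q + cosAngle y p x + cosAngle y q x)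
    {a b c e : ℝ} (h : a + b + c + e = 0) (ha : 0 < a) : 0 ≤ quadForm p q x y a b c e := by
  rcases lt_trichotomy b 0 with hb | rfl | hb
  · rcases lt_trichotomy c 0 with hc | rfl | hc
    · rcases lt_trichotomy e 0 with he | rfl | he
      · rw [← quadForm_neg]
        exact quadForm_nonneg_of_lt_cosAngle_sum hpq hpx hpy hp (by linarith) (by linarith)
          (by linarith) (by linarith)
      · exact quadForm_three_nonneg _ _ _ _ (by linarith)
      · rw [← quadForm_swap_last, ← quadForm_swap_middle]
        exact quadForm_nonneg_of_cat0Quad hqx (hP _ _ _ _) (by linarith) ha he hb hc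
    · exact quadForm_zero_third _ _ _ _ (by linarith)
    · rcases lt_trichotomy e 0 with he | rfl | he
      · rw [← quadForm_swap_middle]
        exact quadForm_nonneg_of_cat0Quad hqy (hP _ _ _ _) (by linarith) ha hc hb he
      · exact quadForm_three_nonneg _ _ _ _ (by linarith)
      · rw [← quadForm_swap_first]
        exact quadForm_nonneg_of_lt_cosAngle_sum hpq.symm hqx hqy hq (by linarith) ha hc he
  · rw [← quadForm_swap_middle]
    exact quadForm_zero_third _ _ _ _ (by linarith)
  · rcases lt_trichotomy c 0 with hc | rfl | hc
    · rcases lt_trichotomy e 0 with he | rfl | he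
      · exact quadForm_nonneg_of_cat0Quad hxy (hP _ _ _ _) (by linarith) ha hb hc he
      · exact quadForm_three_nonneg _ _ _ _ (by linarith)
      · rw [← quadForm_swap_middle, ← quadForm_swap_first]
        exact quadForm_nonneg_of_lt_cosAngle_sum hpx.symm hqx.symm hxy hx (by linarith) ha hb he
    · exact quadForm_zero_third _ _ _ _ (by linarith)
    · rcases lt_trichotomy e 0 with he | rfl | he
      · rw [← quadForm_swap_last, ← quadForm_swap_middle, ← quadForm_swap_first]
        exact quadForm_nonneg_of_lt_cosAngle_sum hpy.symm hqy.symm hxy.symm hy (by linarith)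
          ha hb hc
      · exact quadForm_three_nonneg _ _ _ _ (by linarith)
      · linarith

theorem quadForm_nonneg (hP : Cat0Comparison P) {p q x y : P} (hpq : p ≠ q) (hpx : p ≠ x)
    (hpy : p ≠ y) (hqx : q ≠ x) (hqy : q ≠ y) (hxy : x ≠ y)
    (hp : -1 < cosAngle p q x + cosAngle p q y + cosAngle p x y)
    (hq : -1 < cosAngle q p x + cosAngle q p y + cosAngle q x y)
    (hx : -1 < cosAngle x p q + cosAngle x p y + cosAngle x q y)
    (hy : -1 < cosAngle y p q + cosAngle y p x + cosAngle y q x)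
    {a b c e : ℝ} (h : a + b + c + e = 0) : 0 ≤ quadForm p q x y a b c e := by
  rcases lt_trichotomy a 0 with ha | rfl | ha
  · rw [← quadForm_neg]
    exact quadForm_nonneg_of_pos hP hpq hpx hpy hqx hqy hxy hp hq hx hy (by linarith)
      (by linarith)
  · rw [← quadForm_swap_first, ← quadForm_swap_middle]
    exact quadForm_zero_third _ _ _ _ (by linarith)
  · exact quadForm_nonneg_of_pos hP hpq hpx hpy hqx hqy hxy hp hq hx hy h ha

open scoped MatrixOrder in
/-- A positive semidefinite real matrix is the Gram matrix of vectors in Euclidean space. -/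
theorem Matrix.PosSemidef.exists_euclideanSpace_gram {n : Type*} [Fintype n]
    {M : Matrix n n ℝ} (hM : M.PosSemidef) :
    ∃ v : n → EuclideanSpace ℝ n, ∀ i j, inner ℝ (v i) (v j) = M i j := by
  classical
  obtain ⟨B, rfl⟩ := CStarAlgebra.nonneg_iff_eq_star_mul_self.mp hM.nonneg
  refine ⟨fun i => WithLp.toLp 2 fun k => B k i, fun i j => ?_⟩
  simp [PiLp.inner_apply, Matrix.mul_apply, Matrix.star_apply, mul_comm]

/-- Four points with nonnegative associated form embed in Euclidean space. -/
theorem exists_isometry_of_quadForm_nonneg {p q x y : P}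
    (hcover : ∀ t, t = p ∨ t = q ∨ t = x ∨ t = y)
    (hnn : ∀ a b c e : ℝ, a + b + c + e = 0 → 0 ≤ quadForm p q x y a b c e) :
    ∃ f : P → EuclideanSpace ℝ (Fin 3), Isometry f := by
  let s : Fin 3 → P := ![q, x, y]
  let M : Matrix (Fin 3) (Fin 3) ℝ := Matrix.of fun i j =>
    (dist p (s i) ^ 2 + dist p (s j) ^ 2 - dist (s i) (s j) ^ 2) / 2
  have hM : M.PosSemidef := by
    refine Matrix.posSemidef_iff_dotProduct_mulVec.2 ⟨?_, fun v => ?_⟩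
    · ext i j
      simp only [Matrix.conjTranspose_apply, M, Matrix.of_apply, star_trivial,
        dist_comm (s j) (s i)]
      ring
    · refine (hnn (-(v 0 + v 1 + v 2)) (v 0) (v 1) (v 2) (by ring)).trans_eq ?_
      simp [dotProduct, Matrix.mulVec, Fin.sum_univ_three, M, s, quadForm, dist_comm x q,
        dist_comm y q, dist_comm y x]
      ring
  obtain ⟨v, hv⟩ := hM.exists_euclideanSpace_gram
  have hzero (i : Fin 3) : dist 0 (v i) ^ 2 = dist p (s i) ^ 2 := by
    rw [dist_zero_left, ← real_inner_self_eq_norm_sq, hv]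
    simp [M]
  have hdist (i j : Fin 3) : dist (v i) (v j) ^ 2 = dist (s i) (s j) ^ 2 := by
    rw [dist_eq_norm, norm_sub_sq_real, ← real_inner_self_eq_norm_sq,
      ← real_inner_self_eq_norm_sq, hv, hv, hv]
    simp [M]
    ring
  exact exists_isometry_of_four_points hcover (hzero 0) (hzero 1) (hzero 2) (hdist 0 1)
    (hdist 0 2) (hdist 1 2)

end Comparison

theorem exists_four_points {P : Type*} (hcard : Nat.card P = 4) :
    ∃ p q x y : P, p ≠ q ∧ p ≠ x ∧ p ≠ y ∧ q ≠ x ∧ q ≠ y ∧ x ≠ y ∧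
      ∀ t, t = p ∨ t = q ∨ t = x ∨ t = y := by
  have : Finite P := Nat.finite_of_card_ne_zero (by omega)
  let e : P ≃ Fin 4 := Finite.equivFinOfCardEq hcard
  refine ⟨e.symm 0, e.symm 1, e.symm 2, e.symm 3, by simp, by simp, by simp, by simp, by simp,
    by simp, fun t => ?_⟩
  obtain ⟨i, rfl⟩ := e.symm.surjective t
  fin_cases i <;> simp

/-- A 4-point metric space satisfying the CAT(0) comparison admits a distance-preserving
map into a geodesic metric space satisfying the CAT(0) comparison. -/
theorem four_point_cat0_embeds (P : Type*) [MetricSpace P]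
    (hcard : Nat.card P = 4) (hP : Cat0Comparison P) :
    ∃ (X : Type) (_ : MetricSpace X), IsGeodesicSpace X ∧ Cat0Comparison X ∧
      ∃ f : P → X, Isometry f := by
  obtain ⟨p, q, x, y, hpq, hpx, hpy, hqx, hqy, hxy, hcover⟩ := exists_four_points hcard
  have hprod := Tripod.hasComparisonGeodesics.prod
    (hasComparisonGeodesics_euclideanSpace (Fin 3))
  by_cases hp : cosAngle p q x + cosAngle p q y + cosAngle p x y ≤ -1
  · exact ⟨_, _, hprod.isGeodesicSpace, hprod.cat0Comparison,
      exists_isometry_of_cosAngle_sum_le hcover hpq hpx hpy hp⟩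
  by_cases hq : cosAngle q p x + cosAngle q p y + cosAngle q x y ≤ -1
  · exact ⟨_, _, hprod.isGeodesicSpace, hprod.cat0Comparison,
      exists_isometry_of_cosAngle_sum_le (fun t => by have := hcover t; tauto)
        hpq.symm hqx hqy hq⟩
  by_cases hx : cosAngle x p q + cosAngle x p y + cosAngle x q y ≤ -1
  · exact ⟨_, _, hprod.isGeodesicSpace, hprod.cat0Comparison,
      exists_isometry_of_cosAngle_sum_le (fun t => by have := hcover t; tauto)
        hpx.symm hqx.symm hxy hx⟩
  by_cases hy : cosAngle y p q + cosAngle y p x + cosAngle y q x ≤ -1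
  · exact ⟨_, _, hprod.isGeodesicSpace, hprod.cat0Comparison,
      exists_isometry_of_cosAngle_sum_le (fun t => by have := hcover t; tauto)
        hpy.symm hqy.symm hxy.symm hy⟩
  have hE := hasComparisonGeodesics_euclideanSpace (Fin 3)
  exact ⟨_, _, hE.isGeodesicSpace, hE.cat0Comparison,
    exists_isometry_of_quadForm_nonneg hcover fun a b c e h =>
      quadForm_nonneg hP hpq hpx hpy hqx hqy hxy (not_le.1 hp) (not_le.1 hq) (not_le.1 hx)
        (not_le.1 hy) h⟩
end

section
/- Points x₁,…,xₙ in a metric space admit a distance-preserving map into the Euclidean space ℝ^{n−1} if and only if the associated quadratic form W satisfies W(v) ≥ 0 for every v ∈ ℝ^{n−1}. -/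
/-- The vertices of the standard simplex in `ℝⁿ`: `stdVert n i` for `i < n` is the `i`-th
standard basis vector, and `stdVert n n = 0`.  (These are the points `v₁, …, v_{n+1}`,
indexed from `0`.) -/
noncomputable def stdVert (n : ℕ) (i : Fin (n + 1)) : EuclideanSpace ℝ (Fin n) :=
  if h : (i : ℕ) < n then EuclideanSpace.single ⟨i, h⟩ 1 else 0

/-- A quadratic form is determined by its values on the vectors of a basis and on their
pairwise differences. -/
theorem QuadraticForm.ext_basis_sub {ι E : Type*} [AddCommGroup E] [Module ℝ E]
    (b : Module.Basis ι ℝ E) {P Q : QuadraticForm ℝ E} (h : ∀ i, P (b i) = Q (b i))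
    (h_sub : ∀ i j, P (b i - b j) = Q (b i - b j)) : P = Q := by
  refine QuadraticMap.polarBilin_injective (isUnit_iff_ne_zero.2 two_ne_zero)
    (b.ext fun i => b.ext fun j => ?_)
  have key (R : QuadraticForm ℝ E) :
      R.polarBilin (b i) (b j) = R (b i) + R (b j) - R (b i - b j) := by
    have h1 := QuadraticMap.polar_neg_right R (b i) (b j)
    rw [QuadraticMap.polar, ← sub_eq_add_neg, QuadraticMap.map_neg] at h1
    rw [QuadraticMap.polarBilin_apply_apply]
    linarith
  rw [key, key, h, h, h_sub]

/-- A nonnegative quadratic form on a finite-dimensional real vector space is the pullback of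
the squared Euclidean norm by a linear map. -/
theorem QuadraticForm.exists_linearMap_norm_sq_eq {E : Type*} [AddCommGroup E] [Module ℝ E]
    [FiniteDimensional ℝ E] (Q : QuadraticForm ℝ E) (hQ : ∀ v, 0 ≤ Q v) :
    ∃ T : E →ₗ[ℝ] EuclideanSpace ℝ (Fin (Module.finrank ℝ E)), ∀ v, ‖T v‖ ^ 2 = Q v := by
  obtain ⟨w, ⟨e⟩⟩ := Q.equivalent_weightedSumSquares
  have hw (k) : 0 ≤ w k := by
    have h := hQ (e.symm (Pi.single k 1))
    rw [QuadraticMap.IsometryEquiv.map_app, QuadraticMap.weightedSumSquares_apply] at h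
    simpa [Pi.single_apply] using h
  refine ⟨(WithLp.linearEquiv 2 ℝ _).symm.toLinearMap ∘ₗ
    LinearMap.pi (fun k => √(w k) • LinearMap.proj k) ∘ₗ e.toLinearEquiv.toLinearMap,
    fun v => ?_⟩
  rw [← e.map_app v, QuadraticMap.weightedSumSquares_apply, EuclideanSpace.norm_sq_eq]
  refine Finset.sum_congr rfl fun k _ => ?_
  change ‖√(w k) * e v k‖ ^ 2 = w k * (e v k * e v k)
  rw [Real.norm_eq_abs, sq_abs, mul_pow, Real.sq_sqrt (hw k), sq (e v k)]

theorem stdVert_castSucc (n : ℕ) (i : Fin n) :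
    stdVert n i.castSucc = EuclideanSpace.basisFun (Fin n) ℝ i := by
  simp [stdVert]

theorem stdVert_last (n : ℕ) : stdVert n (Fin.last n) = 0 := by
  simp [stdVert]

/-- Points `x₀, …, xₙ` in a metric space admit a distance-preserving map into the
Euclidean space `ℝⁿ` if and only if the associated quadratic form `W`—the quadratic form
on `ℝⁿ` with `W (vᵢ - vⱼ) = dist (xᵢ) (xⱼ) ^ 2` for the simplex vertices `vᵢ`—is
nonnegative everywhere. -/
theorem embeds_into_euclidean_iff_assoc_form_nonneg {X : Type*} [MetricSpace X]
    (n : ℕ) (x : Fin (n + 1) → X)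
    (W : QuadraticForm ℝ (EuclideanSpace ℝ (Fin n)))
    (hW : ∀ i j, W (stdVert n i - stdVert n j) = dist (x i) (x j) ^ 2) :
    (∃ f : Fin (n + 1) → EuclideanSpace ℝ (Fin n),
        ∀ i j, dist (f i) (f j) = dist (x i) (x j)) ↔
      ∀ v, 0 ≤ W v := by
  constructor
  · rintro ⟨f, hf⟩
    let b := (EuclideanSpace.basisFun (Fin n) ℝ).toBasis
    let L := b.constr ℝ fun i => f i.castSucc - f (Fin.last n)
    have hb (i : Fin n) : b i = stdVert n i.castSucc := by simp [b, stdVert_castSucc]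
    have hL (i : Fin n) : L (b i) = f i.castSucc - f (Fin.last n) := b.constr_basis ℝ _ i
    have hWL : W = (LinearMap.BilinMap.toQuadraticMap
        (innerₗ (EuclideanSpace ℝ (Fin n)))).comp L := by
      refine QuadraticForm.ext_basis_sub b (fun i => ?_) fun i j => ?_
      · have h := hW i.castSucc (Fin.last n)
        rw [stdVert_last, sub_zero, ← hb, ← hf] at h
        rw [h, QuadraticMap.comp_apply, hL, LinearMap.BilinMap.toQuadraticMap_apply,
          innerₗ_apply_apply, real_inner_self_eq_norm_sq, dist_eq_norm]
      · have h := hW i.castSucc j.castSucc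
        rw [← hb, ← hb, ← hf] at h
        rw [h, QuadraticMap.comp_apply, map_sub, hL, hL, sub_sub_sub_cancel_right,
          LinearMap.BilinMap.toQuadraticMap_apply, innerₗ_apply_apply,
          real_inner_self_eq_norm_sq, dist_eq_norm]
    intro v
    rw [hWL]
    exact real_inner_self_nonneg (x := L v)
  · intro h
    obtain ⟨T, hT⟩ := QuadraticForm.exists_linearMap_norm_sq_eq W h
    let S := LinearIsometryEquiv.piLpCongrLeft 2 ℝ ℝ
      (finCongr (finrank_euclideanSpace_fin (𝕜 := ℝ) (n := n)))
    refine ⟨fun i => S (T (stdVert n i)), fun i j => ?_⟩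
    rw [S.dist_map, dist_eq_norm, ← map_sub, ← sq_eq_sq₀ (norm_nonneg _) dist_nonneg, hT, hW]
end

section
/- Let x₁,…,xₙ be points in a metric space with associated quadratic form W on ℝ^{n−1} (with v₁,…,v_{n−1} the standard basis and vₙ = 0). Let L ⊆ ℝ^{n−1} be a linear subspace such that W(v) < 0 for every nonzero v ∈ L, and let π be any linear map on ℝ^{n−1} with kernel L. Then for any three distinct indices i, j, k the points π(vᵢ), π(vⱼ), π(v_k) are affinely independent (in particular pairwise distinct and not collinear). -/
theorem QuadraticMap.map_smul_add_smul_eq_map_sub {R M : Type*} [CommRing R] [AddCommGroup M]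
    [Module R M] (Q : QuadraticForm R M) (a b : R) (u w : M) :
    Q (a • u + b • w) = a ^ 2 * Q u + b ^ 2 * Q w + a * b * (Q u + Q w - Q (u - w)) := by
  have h : Q (u - w) = Q u + Q w - QuadraticMap.polar Q u w := by
    rw [sub_eq_add_neg, QuadraticMap.map_add Q, QuadraticMap.map_neg, QuadraticMap.polar_neg_right]
    ring
  rw [QuadraticMap.map_add Q, QuadraticMap.map_smul, QuadraticMap.map_smul,
    QuadraticMap.polar_smul_left, QuadraticMap.polar_smul_right, h]
  simp only [smul_eq_mul]
  ring

/-- A binary quadratic form given by the squared side lengths of a triangle is nonnegative. -/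
theorem triangle_form_nonneg {p q r : ℝ} (hr : 0 ≤ r)
    (h₁ : p ≤ q + r) (h₂ : q ≤ p + r) (h₃ : r ≤ p + q) (a b : ℝ) :
    0 ≤ a ^ 2 * p ^ 2 + b ^ 2 * q ^ 2 + a * b * (p ^ 2 + q ^ 2 - r ^ 2) := by
  have hlo : 0 ≤ r ^ 2 - (p - q) ^ 2 := by nlinarith
  have hhi : 0 ≤ (p + q) ^ 2 - r ^ 2 := by nlinarith
  rcases le_total 0 (a * b) with hab | hab
  · nlinarith [sq_nonneg (a * p - b * q), mul_nonneg hab hhi]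
  · nlinarith [sq_nonneg (a * p + b * q), mul_nonneg (neg_nonneg.2 hab) hlo]

theorem stdVert_apply (n : ℕ) (i : Fin (n + 1)) (m : Fin n) :
    stdVert n i m = if i = m.castSucc then 1 else 0 := by
  unfold stdVert
  split_ifs with h h' h' <;> simp_all [Fin.ext_iff, eq_comm]

theorem affineIndependent_stdVert (n : ℕ) : AffineIndependent ℝ (stdVert n) := by
  rw [affineIndependent_iff_of_fintype]
  intro w hw h
  rw [Finset.weightedVSub_eq_linear_combination _ hw] at h
  have hcast (m : Fin n) : w m.castSucc = 0 := by
    simpa [stdVert_apply] using congrArg (fun v : EuclideanSpace ℝ (Fin n) => v m) h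
  refine Fin.lastCases ?_ hcast
  simpa [Fin.sum_univ_castSucc, hcast] using hw

/-- Let `W` be the quadratic form on `ℝⁿ` associated to points `x₀, …, xₙ` of a metric
space, let `L` be a linear subspace on whose nonzero vectors `W` is negative, and let `π`
be a linear map with kernel `L`.  Then the projections of any three distinct vertices of
the standard simplex are affinely independent (in particular pairwise distinct and not
collinear). -/
theorem proj_of_three_vertices_affinely_independent {X : Type*} [MetricSpace X]
    (n : ℕ) (x : Fin (n + 1) → X)
    (W : QuadraticForm ℝ (EuclideanSpace ℝ (Fin n)))
    (hW : ∀ i j, W (stdVert n i - stdVert n j) = dist (x i) (x j) ^ 2)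
    (L : Submodule ℝ (EuclideanSpace ℝ (Fin n)))
    (hL : ∀ v ∈ L, v ≠ 0 → W v < 0)
    {F : Type*} [AddCommGroup F] [Module ℝ F]
    (π : EuclideanSpace ℝ (Fin n) →ₗ[ℝ] F)
    (hπ : LinearMap.ker π = L)
    (i j k : Fin (n + 1)) (hij : i ≠ j) (hjk : j ≠ k) (hik : i ≠ k) :
    AffineIndependent ℝ ![π (stdVert n i), π (stdVert n j), π (stdVert n k)] := by
  have hv : AffineIndependent ℝ ![stdVert n i, stdVert n j, stdVert n k] := by
    have hinj : Function.Injective ![i, j, k] := by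
      intro s t
      fin_cases s <;> fin_cases t <;> simp [hij, hjk, hik, hij.symm, hjk.symm, hik.symm]
    convert (affineIndependent_stdVert n).comp_embedding ⟨_, hinj⟩ using 1
    ext s
    fin_cases s <;> rfl
  rw [affineIndependent_iff_of_fintype] at hv ⊢
  intro w hw h
  refine hv w hw ?_
  rw [Finset.weightedVSub_eq_linear_combination _ hw] at h ⊢
  simp only [Fin.sum_univ_three, Matrix.cons_val] at hw h ⊢
  by_contra hne
  have hneg := hL _ (by rw [← hπ, LinearMap.mem_ker]; simpa using h) hne
  have hcomb : w 0 • stdVert n i + w 1 • stdVert n j + w 2 • stdVert n k =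
      w 0 • (stdVert n i - stdVert n j) + w 2 • (stdVert n k - stdVert n j) := by
    rw [show w 1 = -w 0 - w 2 by linarith]
    module
  rw [hcomb, QuadraticMap.map_smul_add_smul_eq_map_sub, sub_sub_sub_cancel_right, hW, hW, hW]
    at hneg
  refine hneg.not_ge (triangle_form_nonneg dist_nonneg ?_ ?_ ?_ _ _)
  · linarith [dist_triangle (x i) (x k) (x j)]
  · linarith [dist_triangle_left (x k) (x j) (x i)]
  · exact dist_triangle_right _ _ _
end

section
/- Let x₁, x₂, x₃, x₄ be points in a metric space with associated quadratic form W on ℝ³. Then every linear subspace L ⊆ ℝ³ with W(v) < 0 for all nonzero v ∈ L has dimension at most 1; that is, W has at most one negative eigenvalue. -/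
/-- A real quadratic form is nonnegative on the span of `u` and `v` if the square roots of its
values at `u`, `v`, `u - v` are the side lengths of a (possibly degenerate) triangle. -/
theorem QuadraticMap.nonneg_smul_add_smul_of_triangle {E : Type*} [AddCommGroup E] [Module ℝ E]
    (W : QuadraticForm ℝ E) {u v : E} {p q r : ℝ} (hp : 0 ≤ p) (hq : 0 ≤ q) (hr : 0 ≤ r)
    (hu : W u = p ^ 2) (hv : W v = q ^ 2) (huv : W (u - v) = r ^ 2)
    (hpqr : p ≤ q + r) (hqpr : q ≤ p + r) (hrpq : r ≤ p + q) (a b : ℝ) :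
    0 ≤ W (a • u + b • v) := by
  have hpolar : QuadraticMap.polar W u v = p ^ 2 + q ^ 2 - r ^ 2 := by
    have h := QuadraticMap.map_add W u (-v)
    rw [← sub_eq_add_neg, QuadraticMap.map_neg, QuadraticMap.polar_neg_right, hu, hv, huv] at h
    linarith
  rw [QuadraticMap.map_add W, QuadraticMap.map_smul, QuadraticMap.map_smul,
    QuadraticMap.polar_smul_left, QuadraticMap.polar_smul_right, hpolar, hu, hv]
  simp only [smul_eq_mul]
  have h₁ : 0 ≤ r ^ 2 - (p - q) ^ 2 := by nlinarith
  have h₂ : 0 ≤ (p + q) ^ 2 - r ^ 2 := by nlinarith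
  rcases le_total 0 (a * b) with hab | hab
  · nlinarith [mul_nonneg hab h₂, sq_nonneg (a * p - b * q)]
  · nlinarith [mul_nonneg (neg_nonneg.2 hab) h₁, sq_nonneg (a * p + b * q)]

/-- Let `W` be the quadratic form on `ℝ³` associated to four points of a metric space.
Then every linear subspace of `ℝ³` on whose nonzero vectors `W` is negative has dimension
at most `1`; that is, `W` has at most one negative eigenvalue. -/
theorem assoc_form_of_four_points_at_most_one_negative {X : Type*} [MetricSpace X]
    (x : Fin 4 → X)
    (W : QuadraticForm ℝ (EuclideanSpace ℝ (Fin 3)))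
    (hW : ∀ i j, W (stdVert 3 i - stdVert 3 j) = dist (x i) (x j) ^ 2)
    (L : Submodule ℝ (EuclideanSpace ℝ (Fin 3)))
    (hL : ∀ v ∈ L, v ≠ 0 → W v < 0) :
    Module.finrank ℝ L ≤ 1 := by
  by_contra! hdim
  -- A plane in `ℝ³` meets the plane spanned by the first two basis vectors nontrivially.
  let f : L →ₗ[ℝ] ℝ := (EuclideanSpace.proj (2 : Fin 3)).toLinearMap ∘ₗ L.subtype
  have hker : LinearMap.ker f ≠ ⊥ := LinearMap.ker_ne_bot_of_finrank_lt (by simpa using hdim)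
  obtain ⟨⟨v, hvL⟩, hvf, hv0⟩ := (Submodule.ne_bot_iff _).1 hker
  have hv2 : v 2 = 0 := hvf
  have hv : v = v 0 • stdVert 3 0 + v 1 • stdVert 3 1 := by
    ext i
    fin_cases i <;> simp [stdVert, hv2]
  have h3 : stdVert 3 3 = 0 := by simp [stdVert]
  have h03 := hW 0 3
  have h13 := hW 1 3
  rw [h3, sub_zero] at h03 h13
  have hnonneg := QuadraticMap.nonneg_smul_add_smul_of_triangle W dist_nonneg dist_nonneg
    dist_nonneg h03 h13 (hW 0 1)
    (by linarith [dist_triangle (x 0) (x 1) (x 3)])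
    (by linarith [dist_triangle_left (x 1) (x 3) (x 0)])
    (by linarith [dist_triangle_right (x 0) (x 1) (x 3)]) (v 0) (v 1)
  rw [← hv] at hnonneg
  exact (hL v hvL fun h => hv0 (Subtype.ext h)).not_ge hnonneg
end

section
/- Let x₁, x₂, x₃, x₄ be points in a metric space such that the quadruple (x₂, x₄, x₁, x₃), in the roles (p, q, x, y), satisfies the CAT(0) (2+2) comparison. Let W be the associated quadratic form on ℝ³ (with v₁, v₂, v₃ the standard basis and v₄ = 0), let w ∈ ℝ³ satisfy W(w) < 0, and let π : ℝ³ → ℝ² be a linear map whose kernel is the line spanned by w. Then the open segments with endpoints π(v₁), π(v₃) and with endpoints π(v₂), π(v₄) do not intersect. -/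
theorem QuadraticMap.map_linearCombination_three {E : Type*} [AddCommGroup E] [Module ℝ E]
    (W : QuadraticForm ℝ E) (a b c : ℝ) (x y z : E) :
    W (a • x + b • y + c • z) = a ^ 2 * W x + b ^ 2 * W y + c ^ 2 * W z
      + a * b * (W x + W y - W (x - y)) + a * c * (W x + W z - W (x - z))
      + b * c * (W y + W z - W (y - z)) := by
  have map_add (u v : E) : W (u + v) = W u + W v + QuadraticMap.polar W u v :=
    QuadraticMap.map_add W u v
  have map_sub (u v : E) : W (u - v) = W u + W v - QuadraticMap.polar W u v := by
    rw [sub_eq_add_neg, map_add, QuadraticMap.map_neg, QuadraticMap.polar_neg_right]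
    ring
  simp only [map_sub, map_add, QuadraticMap.map_smul, QuadraticMap.polar_add_left,
    QuadraticMap.polar_smul_left, QuadraticMap.polar_smul_right, smul_eq_mul]
  ring

/-- Stewart's theorem. -/
theorem dist_convexCombination_sq {E : Type*} [NormedAddCommGroup E] [InnerProductSpace ℝ E]
    (p x y : E) (a b : ℝ) (hab : a + b = 1) :
    dist p (a • x + b • y) ^ 2
      = a * dist p x ^ 2 + b * dist p y ^ 2 - a * b * dist x y ^ 2 := by
  obtain rfl : a = 1 - b := by linarith
  have hz : p - ((1 - b) • x + b • y) = (1 - b) • (p - x) + b • (p - y) := by module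
  have hxy : x - y = (p - y) - (p - x) := by abel
  have hadd := norm_add_sq_real ((1 - b) • (p - x)) (b • (p - y))
  have hsub := norm_sub_sq_real (p - y) (p - x)
  rw [norm_smul, norm_smul, mul_pow, mul_pow, real_inner_smul_left, real_inner_smul_right,
    Real.norm_eq_abs, Real.norm_eq_abs, sq_abs, sq_abs] at hadd
  rw [real_inner_comm] at hsub
  simp only [dist_eq_norm]
  rw [hz, hxy]
  linear_combination hadd + (1 - b) * b * hsub

/-- The four-point inequality satisfied by CAT(0) (2+2) comparison quadruples. -/
theorem Cat0Quad.four_point {X : Type*} [MetricSpace X] {p q x y : X}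
    (h : Cat0Quad (fun a b => dist a b) p q x y) {a b c e : ℝ} (ha : 0 ≤ a) (hb : 0 ≤ b)
    (hab : a + b = 1) (hc : 0 ≤ c) (he : 0 ≤ e) (hce : c + e = 1) :
    a * b * dist x y ^ 2 + c * e * dist p q ^ 2
      ≤ c * (a * dist p x ^ 2 + b * dist p y ^ 2) + e * (a * dist q x ^ 2 + b * dist q y ^ 2) := by
  obtain ⟨p', q', x', y', hxy, hpx, hpy, hqx, hqy, -, hz⟩ := h
  have hpq := hz (a • x' + b • y') ⟨a, b, ha, hb, hab, rfl⟩
  have hp := dist_convexCombination_sq p' x' y' a b hab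
  have hq := dist_convexCombination_sq q' x' y' a b hab
  rw [dist_comm _ q'] at hpq
  simp only at hxy hpx hpy hqx hqy hpq
  rw [hxy, hpx, hpy] at hp
  rw [hxy, hqx, hqy] at hq
  set P := dist p' (a • x' + b • y')
  set Q := dist q' (a • x' + b • y')
  have hsq : dist p q ^ 2 ≤ (P + Q) ^ 2 := pow_le_pow_left₀ dist_nonneg hpq 2
  have hmul := mul_le_mul_of_nonneg_left hsq (mul_nonneg hc he)
  obtain rfl : c = 1 - e := by linarith
  obtain rfl : a = 1 - b := by linarith
  linear_combination hmul + sq_nonneg ((1 - e) * P - e * Q) + (1 - e) * hp + e * hq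

/-- Let `x 0, x 1, x 2, x 3` (the points `x₁, x₂, x₃, x₄`) be points in a metric space
such that the quadruple `(x₂, x₄, x₁, x₃)`, in the roles `(p, q, x, y)`, satisfies the
CAT(0) (2+2) comparison.  Let `W` be the associated quadratic form on `ℝ³`, let `w`
satisfy `W w < 0`, and let `π : ℝ³ → ℝ²` be a linear map whose kernel is the line spanned
by `w`.  Then the open segments `(π v₁, π v₃)` and `(π v₂, π v₄)` do not intersect. -/
theorem diagonals_do_not_cross {X : Type*} [MetricSpace X] (x : Fin 4 → X)
    (hcomp : Cat0Quad (fun a b => dist a b) (x 1) (x 3) (x 0) (x 2))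
    (W : QuadraticForm ℝ (EuclideanSpace ℝ (Fin 3)))
    (hW : ∀ i j, W (stdVert 3 i - stdVert 3 j) = dist (x i) (x j) ^ 2)
    (w : EuclideanSpace ℝ (Fin 3)) (hw : W w < 0)
    (π : EuclideanSpace ℝ (Fin 3) →ₗ[ℝ] EuclideanSpace ℝ (Fin 2))
    (hπ : LinearMap.ker π = Submodule.span ℝ {w}) :
    openSegment ℝ (π (stdVert 3 0)) (π (stdVert 3 2)) ∩
      openSegment ℝ (π (stdVert 3 1)) (π (stdVert 3 3)) = ∅ := by
  rw [Set.eq_empty_iff_forall_notMem]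
  rintro _ ⟨⟨a, b, ha, hb, hab, rfl⟩, ⟨c, e, hc, he, hce, h⟩⟩
  have hv : stdVert 3 3 = 0 := dif_neg (by decide)
  have hker : a • stdVert 3 0 + b • stdVert 3 2 + (-c) • stdVert 3 1 ∈ LinearMap.ker π := by
    rw [hv, map_zero, smul_zero, add_zero] at h
    rw [LinearMap.mem_ker, map_add, map_add, map_smul, map_smul, map_smul, ← h]
    module
  rw [hπ, Submodule.mem_span_singleton] at hker
  obtain ⟨k, hk⟩ := hker
  have hk0 : k ≠ 0 := by
    rintro rfl
    have := congrArg (fun u : EuclideanSpace ℝ (Fin 3) => u 0) hk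
    simp [stdVert] at this
    exact ha.ne this
  have hneg : W (a • stdVert 3 0 + b • stdVert 3 2 + (-c) • stdVert 3 1) < 0 := by
    rw [← hk, QuadraticMap.map_smul]
    exact mul_neg_of_pos_of_neg (mul_self_pos.2 hk0) hw
  have hW3 (i : Fin 4) : W (stdVert 3 i) = dist (x i) (x 3) ^ 2 := by
    rw [← hW, hv, sub_zero]
  rw [QuadraticMap.map_linearCombination_three, hW, hW, hW, hW3, hW3, hW3] at hneg
  have hfour := hcomp.four_point ha.le hb.le hab hc.le he.le hce
  rw [dist_comm (x 1) (x 0), dist_comm (x 1) (x 2), dist_comm (x 3) (x 0),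
    dist_comm (x 3) (x 2)] at hfour
  obtain rfl : a = 1 - b := by linarith
  obtain rfl : c = 1 - e := by linarith
  linarith
end

section
/- Let x₁,…,x₅ be points in a metric space satisfying the CAT(0) comparison, with associated quadratic form W on ℝ⁴. Then every linear subspace L ⊆ ℝ⁴ with W(v) < 0 for all nonzero v ∈ L has dimension at most 1. -/
open Finset

/-- The value of a quadratic form at a combination with total weight zero, expressed
through its values at the differences of the vertices. -/
theorem QuadraticMap.two_mul_map_sum_smul {ι E : Type*} [Fintype ι] [AddCommGroup E] [Module ℝ E]
    (W : QuadraticForm ℝ E) (s : ι → E) (c : ι → ℝ) (hc : ∑ i, c i = 0) :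
    2 * W (∑ i, c i • s i) = -∑ i, ∑ j, c i * c j * W (s i - s j) := by
  have hpolar : W.polarBilin (∑ i, c i • s i) (∑ i, c i • s i) = 2 * W (∑ i, c i • s i) := by
    rw [QuadraticMap.polarBilin_apply_apply, QuadraticMap.polar_self, two_nsmul, two_mul]
  have hsub (i j : ι) : W (s i - s j) = W (s i) + W (s j) - W.polarBilin (s i) (s j) := by
    have h := QuadraticMap.polar_neg_right W (s i) (s j)
    simp only [QuadraticMap.polar, QuadraticMap.map_neg, ← sub_eq_add_neg] at h
    simp only [QuadraticMap.polarBilin_apply_apply, QuadraticMap.polar]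
    linarith
  have hleft : ∑ i, ∑ j, c i * c j * W (s i) = 0 := by
    have (i j : ι) : c i * c j * W (s i) = (c i * W (s i)) * c j := by ring
    simp_rw [this, ← mul_sum, hc, mul_zero, sum_const_zero]
  have hright : ∑ i, ∑ j, c i * c j * W (s j) = 0 := by
    have (i j : ι) : c i * c j * W (s j) = c i * (c j * W (s j)) := by ring
    simp_rw [this, ← sum_mul_sum, hc, zero_mul]
  have hexpand : W.polarBilin (∑ i, c i • s i) (∑ i, c i • s i)
      = ∑ i, ∑ j, c i * c j * W.polarBilin (s i) (s j) := by
    simp only [map_sum, LinearMap.sum_apply, map_smul, LinearMap.smul_apply, smul_eq_mul, mul_sum]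
    rw [sum_comm]
    exact sum_congr rfl fun i _ => sum_congr rfl fun j _ => by ring
  rw [← hpolar, hexpand]
  simp_rw [hsub, mul_sub, mul_add, sum_sub_distrib, sum_add_distrib]
  rw [hleft, hright]
  ring

/-- Stewart's theorem with unnormalized weights. -/
theorem sq_mul_dist_sq_combination {E : Type*} [NormedAddCommGroup E] [InnerProductSpace ℝ E]
    (p x y : E) {c d s : ℝ} (hs : s ≠ 0) (hcd : c + d = s) :
    s ^ 2 * dist p ((c / s) • x + (d / s) • y) ^ 2
      = c * s * dist p x ^ 2 + d * s * dist p y ^ 2 - c * d * dist x y ^ 2 := by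
  have hsmul : s • (p - ((c / s) • x + (d / s) • y)) = c • (p - x) + d • (p - y) := by
    rw [smul_sub, smul_add, smul_smul, smul_smul, mul_div_cancel₀ _ hs, mul_div_cancel₀ _ hs,
      ← hcd, add_smul, smul_sub, smul_sub]
    abel
  have hxy : x - y = (p - y) - (p - x) := by abel
  have hleft : s ^ 2 * dist p ((c / s) • x + (d / s) • y) ^ 2
      = ‖c • (p - x) + d • (p - y)‖ ^ 2 := by
    rw [← hsmul, norm_smul, mul_pow, dist_eq_norm, Real.norm_eq_abs, sq_abs]
  rw [hleft, dist_eq_norm, dist_eq_norm, dist_eq_norm, hxy, norm_add_sq_real,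
    norm_sub_sq_real (p - y) (p - x),
    norm_smul, norm_smul, mul_pow, mul_pow, Real.norm_eq_abs, Real.norm_eq_abs, sq_abs, sq_abs,
    inner_smul_left, inner_smul_right, real_inner_comm (p - y) (p - x), ← hcd]
  simp only [conj_trivial]
  ring

theorem Cat0Quad.weighted_sum_nonpos {X : Type*} {dX : X → X → ℝ} {p q x y : X}
    (h : Cat0Quad dX p q x y) (hpq : 0 ≤ dX p q) {a b c d : ℝ} (ha : 0 ≤ a) (hb : 0 ≤ b)
    (hc : c ≤ 0) (hd : d ≤ 0) (hsum : a + b + c + d = 0) :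
    a * b * dX p q ^ 2 + a * c * dX p x ^ 2 + a * d * dX p y ^ 2 + b * c * dX q x ^ 2
      + b * d * dX q y ^ 2 + c * d * dX x y ^ 2 ≤ 0 := by
  rcases (add_nonneg ha hb).eq_or_lt with hs | hs
  · obtain rfl : a = 0 := by linarith
    obtain rfl : b = 0 := by linarith
    obtain rfl : c = 0 := by linarith
    simp
  obtain ⟨p', q', x', y', hxy, hpx, hpy, hqx, hqy, -, hz⟩ := h
  have hcd : -c + -d = a + b := by linarith
  have hseg : (-c / (a + b)) • x' + (-d / (a + b)) • y' ∈ segment ℝ x' y' := by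
    refine ⟨_, _, div_nonneg (by linarith) hs.le, div_nonneg (by linarith) hs.le, ?_, rfl⟩
    rw [← add_div, hcd, div_self hs.ne']
  have hp := sq_mul_dist_sq_combination p' x' y' hs.ne' hcd
  have hq := sq_mul_dist_sq_combination q' x' y' hs.ne' hcd
  have hle := hz _ hseg
  rw [dist_comm _ q'] at hle
  rw [hpx, hpy, hxy] at hp
  rw [hqx, hqy, hxy] at hq
  generalize dist p' _ = A at hp hle
  generalize dist q' _ = B at hq hle
  have hsq : a * b * dX p q ^ 2 ≤ a * b * (A + B) ^ 2 := by gcongr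
  have hmul : (a + b) * (a * b * dX p q ^ 2 + a * c * dX p x ^ 2 + a * d * dX p y ^ 2
      + b * c * dX q x ^ 2 + b * d * dX q y ^ 2 + c * d * dX x y ^ 2)
      = (a + b) * (a * b * dX p q ^ 2 - (a + b) * (a * A ^ 2 + b * B ^ 2)) := by
    linear_combination a * hp + b * hq
  rw [mul_left_cancel₀ hs.ne' hmul]
  nlinarith [sq_nonneg (a * A - b * B)]

theorem Cat0Comparison.weighted_sum_nonpos {X : Type*} [MetricSpace X] (hX : Cat0Comparison X)
    (p q x y : X) {a b c d : ℝ} (hsum : a + b + c + d = 0) (hprod : 0 ≤ a * b * c * d) :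
    a * b * dist p q ^ 2 + a * c * dist p x ^ 2 + a * d * dist p y ^ 2 + b * c * dist q x ^ 2
      + b * d * dist q y ^ 2 + c * d * dist x y ^ 2 ≤ 0 := by
  have hsplit : (0 ≤ a ∧ 0 ≤ b ∧ c ≤ 0 ∧ d ≤ 0) ∨ (a ≤ 0 ∧ b ≤ 0 ∧ 0 ≤ c ∧ 0 ≤ d) ∨
      (0 ≤ a ∧ 0 ≤ c ∧ b ≤ 0 ∧ d ≤ 0) ∨ (a ≤ 0 ∧ c ≤ 0 ∧ 0 ≤ b ∧ 0 ≤ d) ∨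
      (0 ≤ a ∧ 0 ≤ d ∧ b ≤ 0 ∧ c ≤ 0) ∨ (a ≤ 0 ∧ d ≤ 0 ∧ 0 ≤ b ∧ 0 ≤ c) := by
    rcases hprod.eq_or_lt with h | h
    · have h0 : a = 0 ∨ b = 0 ∨ c = 0 ∨ d = 0 := by simpa [or_assoc] using h.symm
      grind
    · rw [mul_assoc, mul_pos_iff, mul_pos_iff, mul_pos_iff, mul_neg_iff, mul_neg_iff] at h
      grind
  have hopp (p q x y : X) {a b c d : ℝ} (ha : 0 ≤ a) (hb : 0 ≤ b) (hc : c ≤ 0) (hd : d ≤ 0)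
      (hsum : a + b + c + d = 0) :=
    (hX p q x y).weighted_sum_nonpos dist_nonneg ha hb hc hd hsum
  rcases hsplit with ⟨h₁, h₂, h₃, h₄⟩ | ⟨h₁, h₂, h₃, h₄⟩ | ⟨h₁, h₂, h₃, h₄⟩ |
    ⟨h₁, h₂, h₃, h₄⟩ | ⟨h₁, h₂, h₃, h₄⟩ | ⟨h₁, h₂, h₃, h₄⟩
  · exact hopp p q x y h₁ h₂ h₃ h₄ hsum
  · have := hopp x y p q h₃ h₄ h₁ h₂ (by linarith)
    rw [dist_comm x p, dist_comm x q, dist_comm y p, dist_comm y q] at this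
    linarith
  · have := hopp p x q y h₁ h₂ h₃ h₄ (by linarith)
    rw [dist_comm x q] at this
    linarith
  · have := hopp q y p x h₃ h₄ h₁ h₂ (by linarith)
    rw [dist_comm q p, dist_comm y p, dist_comm y x] at this
    linarith
  · have := hopp p y q x h₁ h₂ h₃ h₄ (by linarith)
    rw [dist_comm y q, dist_comm y x] at this
    linarith
  · have := hopp q x p y h₃ h₄ h₁ h₂ (by linarith)
    rw [dist_comm q p, dist_comm x p] at this
    linarith

/-- The barycentric coordinates, of total weight zero, of a vector with respect to the vertices
`stdVert n`. -/
def stdCoord (n : ℕ) : EuclideanSpace ℝ (Fin n) →ₗ[ℝ] (Fin (n + 1) → ℝ) where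
  toFun v := Fin.snoc (α := fun _ => ℝ) v (-∑ i, v i)
  map_add' u v := by
    ext i
    refine Fin.lastCases ?_ (fun i => ?_) i <;> simp [sum_add_distrib, add_comm]
  map_smul' a v := by
    ext i
    refine Fin.lastCases ?_ (fun i => ?_) i <;> simp [mul_sum]

theorem stdCoord_castSucc {n : ℕ} (v : EuclideanSpace ℝ (Fin n)) (i : Fin n) :
    stdCoord n v i.castSucc = v i := by
  simp [stdCoord]

theorem sum_stdCoord {n : ℕ} (v : EuclideanSpace ℝ (Fin n)) : ∑ i, stdCoord n v i = 0 := by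
  simp [stdCoord, Fin.sum_univ_castSucc]

theorem sum_stdCoord_smul_stdVert {n : ℕ} (v : EuclideanSpace ℝ (Fin n)) :
    ∑ i, stdCoord n v i • stdVert n i = v := by
  ext k
  simp [Fin.sum_univ_castSucc, stdCoord_castSucc, stdVert, Pi.single_apply]

theorem Cat0Comparison.prod_stdCoord_neg {X : Type*} [MetricSpace X] (hX : Cat0Comparison X)
    (x : Fin 5 → X) (W : QuadraticForm ℝ (EuclideanSpace ℝ (Fin 4)))
    (hW : ∀ i j, W (stdVert 4 i - stdVert 4 j) = dist (x i) (x j) ^ 2)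
    {v : EuclideanSpace ℝ (Fin 4)} (hv : W v < 0) {i : Fin 5} (hi : stdCoord 4 v i = 0) :
    ∏ k, stdCoord 4 v (i.succAbove k) < 0 := by
  have hform := QuadraticMap.two_mul_map_sum_smul W (stdVert 4) _ (sum_stdCoord v)
  have hsum := sum_stdCoord v
  rw [sum_stdCoord_smul_stdVert] at hform
  simp only [hW, Fin.sum_univ_succAbove _ i, hi] at hform hsum
  simp only [zero_mul, mul_zero, sum_const_zero, zero_add, Fin.sum_univ_four,
    dist_self] at hform hsum
  rw [Fin.prod_univ_four]
  by_contra! hprod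
  have := hX.weighted_sum_nonpos (x (i.succAbove 0)) (x (i.succAbove 1)) (x (i.succAbove 2))
    (x (i.succAbove 3)) hsum hprod
  simp only [dist_comm (x (i.succAbove 1)) (x (i.succAbove 0)),
    dist_comm (x (i.succAbove 2)) (x (i.succAbove 0)),
    dist_comm (x (i.succAbove 3)) (x (i.succAbove 0)),
    dist_comm (x (i.succAbove 2)) (x (i.succAbove 1)),
    dist_comm (x (i.succAbove 3)) (x (i.succAbove 1)),
    dist_comm (x (i.succAbove 3)) (x (i.succAbove 2))] at hform
  linarith

/-- A tournament on five vertices cannot have all out-degrees odd. -/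
theorem not_forall_prod_succAbove_neg_of_antisymm (D : Fin 5 → Fin 5 → ℝ)
    (hD : ∀ i j, D j i = -D i j) : ¬ ∀ i, ∏ k, D i (i.succAbove k) < 0 := by
  intro h
  have hneg : (∏ i, ∏ k, D i (i.succAbove k)) < 0 := by
    rw [Fin.prod_univ_five]
    exact mul_neg_of_pos_of_neg (mul_pos_of_neg_of_neg (mul_neg_of_pos_of_neg
      (mul_pos_of_neg_of_neg (h 0) (h 1)) (h 2)) (h 3)) (h 4)
  have hsq : (∏ i, ∏ k, D i (i.succAbove k)) = (D 0 1 * D 0 2 * D 0 3 * D 0 4 * D 1 2 * D 1 3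
      * D 1 4 * D 2 3 * D 2 4 * D 3 4) ^ 2 := by
    simp only [Fin.prod_univ_five, Fin.prod_univ_four]
    change (D 0 1 * D 0 2 * D 0 3 * D 0 4) * (D 1 0 * D 1 2 * D 1 3 * D 1 4) *
      (D 2 0 * D 2 1 * D 2 3 * D 2 4) * (D 3 0 * D 3 1 * D 3 2 * D 3 4) *
      (D 4 0 * D 4 1 * D 4 2 * D 4 3) = _
    rw [hD 0 1, hD 0 2, hD 0 3, hD 0 4, hD 1 2, hD 1 3, hD 1 4, hD 2 3, hD 2 4, hD 3 4]
    ring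
  exact (hsq ▸ hneg).not_ge (sq_nonneg _)

/-- Let `x₁, …, x₅` be points in a metric space satisfying the CAT(0) comparison, with
associated quadratic form `W` on `ℝ⁴`.  Then every linear subspace `L ⊆ ℝ⁴` with
`W v < 0` for all nonzero `v ∈ L` has dimension at most `1`. -/
theorem assoc_form_of_five_points_at_most_one_negative {X : Type*} [MetricSpace X]
    (hX : Cat0Comparison X) (x : Fin 5 → X)
    (W : QuadraticForm ℝ (EuclideanSpace ℝ (Fin 4)))
    (hW : ∀ i j, W (stdVert 4 i - stdVert 4 j) = dist (x i) (x j) ^ 2)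
    (L : Submodule ℝ (EuclideanSpace ℝ (Fin 4)))
    (hL : ∀ v ∈ L, v ≠ 0 → W v < 0) :
    Module.finrank ℝ L ≤ 1 := by
  by_contra! hfin
  have : Nontrivial L := Module.nontrivial_of_finrank_pos (R := ℝ) (by omega)
  obtain ⟨u, hu⟩ := exists_ne (0 : L)
  obtain ⟨v, huv⟩ := exists_linearIndependent_pair_of_one_lt_finrank hfin hu
  rw [LinearIndependent.pair_iff] at huv
  set D : Fin 5 → Fin 5 → ℝ := fun i j =>
    stdCoord 4 u i * stdCoord 4 v j - stdCoord 4 v i * stdCoord 4 u j with hD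
  have hprod (i : Fin 5) (hi : stdCoord 4 (u : EuclideanSpace ℝ (Fin 4)) i ≠ 0 ∨
      stdCoord 4 (v : EuclideanSpace ℝ (Fin 4)) i ≠ 0) : ∏ k, D i (i.succAbove k) < 0 := by
    set w : L := stdCoord 4 u i • v - stdCoord 4 v i • u with hw
    have hw0 : w ≠ 0 := by
      intro h
      have := huv (-stdCoord 4 v i) (stdCoord 4 u i) (by rw [← h, hw]; module)
      rcases hi with hi | hi
      · exact hi this.2
      · exact hi (neg_eq_zero.mp this.1)
    have hcoord (j : Fin 5) : stdCoord 4 w j = D i j := by simp [hw, hD]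
    have hneg := hX.prod_stdCoord_neg x W hW (hL w w.2 (by simpa using hw0)) (i := i)
      (by rw [hcoord, hD]; ring)
    simpa only [hcoord] using hneg
  obtain ⟨j, hj⟩ : ∃ j, stdCoord 4 (u : EuclideanSpace ℝ (Fin 4)) j ≠ 0 := by
    by_contra! h
    apply hu
    ext k
    simpa [stdCoord_castSucc] using h k.castSucc
  refine not_forall_prod_succAbove_neg_of_antisymm D (fun i j => by simp only [hD]; ring)
    fun i => hprod i ?_
  by_contra! h
  have hne : i ≠ j := fun hij => hj (hij ▸ h.1)
  obtain ⟨k, hk⟩ := Fin.exists_succAbove_eq hne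
  exact (hprod j (Or.inl hj)).ne (prod_eq_zero (mem_univ k) (by simp [hk, hD, h.1, h.2]))
end

section
/- Let Q ⊆ 𝒜 ⊆ (ℝ³)⁵ be a connected subset (in the subspace topology) with Q ∩ 𝒜₀ = ∅. Then either Q ⊆ 𝒜₊ or Q ⊆ 𝒜₋. -/
/-- Orientation sign of the `i`-th facet. -/
noncomputable def facetSign (y : Fin 5 → EuclideanSpace ℝ (Fin 3)) (i : Fin 5) : ℝ :=
  Real.sign ((-1 : ℝ) ^ ((i : ℕ) + 1) *
    Matrix.det (Matrix.of fun a b : Fin 3 =>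
      (y (Fin.succAbove i b.succ) - y (Fin.succAbove i 0)) a))

def MemA (y : Fin 5 → EuclideanSpace ℝ (Fin 3)) : Prop :=
  ¬ Coplanar ℝ (Set.range y) ∧
    ∀ i j k : Fin 5, i ≠ j → j ≠ k → i ≠ k →
      ¬ Collinear ℝ ({y i, y j, y k} : Set (EuclideanSpace ℝ (Fin 3)))

noncomputable def nPlus (y : Fin 5 → EuclideanSpace ℝ (Fin 3)) : ℕ :=
  Nat.card {i : Fin 5 // facetSign y i = 1}

noncomputable def nMinus (y : Fin 5 → EuclideanSpace ℝ (Fin 3)) : ℕ :=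
  Nat.card {i : Fin 5 // facetSign y i = -1}

noncomputable def nZero (y : Fin 5 → EuclideanSpace ℝ (Fin 3)) : ℕ :=
  Nat.card {i : Fin 5 // facetSign y i = 0}

noncomputable def mVal (y : Fin 5 → EuclideanSpace ℝ (Fin 3)) : ℤ :=
  (nMinus y : ℤ) - (nPlus y : ℤ)

/-- The signed volume of the `i`-th facet, whose sign is `facetSign y i`. -/
noncomputable def facetVol (y : Fin 5 → EuclideanSpace ℝ (Fin 3)) (i : Fin 5) : ℝ :=
  (-1 : ℝ) ^ ((i : ℕ) + 1) *
    Matrix.det (Matrix.of fun a b : Fin 3 =>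
      (y (Fin.succAbove i b.succ) - y (Fin.succAbove i 0)) a)

lemma facetSign_eq_sign_facetVol (y : Fin 5 → EuclideanSpace ℝ (Fin 3)) (i : Fin 5) :
    facetSign y i = Real.sign (facetVol y i) := rfl

lemma continuous_facetVol (i : Fin 5) : Continuous fun y => facetVol y i := by
  unfold facetVol
  refine continuous_const.mul (Continuous.matrix_det ?_)
  refine continuous_matrix fun a b => ?_
  simp only [Matrix.of_apply, PiLp.sub_apply]
  fun_prop

lemma Real.sign_eq_one_iff_pos (x : ℝ) : Real.sign x = 1 ↔ 0 < x := by
  rcases lt_trichotomy x 0 with h | h | h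
  · rw [Real.sign_of_neg h]; constructor <;> intro h' <;> linarith
  · simp [h]
  · simp [Real.sign_of_pos h, h]

lemma Real.sign_eq_neg_one_iff_neg (x : ℝ) : Real.sign x = -1 ↔ x < 0 := by
  rw [← neg_pos, ← Real.sign_eq_one_iff_pos, Real.sign_neg, neg_eq_iff_eq_neg]

lemma nPlus_eq_card (y : Fin 5 → EuclideanSpace ℝ (Fin 3)) :
    nPlus y = (Finset.univ.filter fun i => 0 < facetVol y i).card := by
  simp only [nPlus, facetSign_eq_sign_facetVol, Real.sign_eq_one_iff_pos]
  rw [Nat.card_eq_fintype_card, Fintype.card_subtype]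

lemma nMinus_eq_card (y : Fin 5 → EuclideanSpace ℝ (Fin 3)) :
    nMinus y = (Finset.univ.filter fun i => facetVol y i < 0).card := by
  simp only [nMinus, facetSign_eq_sign_facetVol, Real.sign_eq_neg_one_iff_neg]
  rw [Nat.card_eq_fintype_card, Fintype.card_subtype]

/-- Positivity of at least `n` members of a finite family of continuous functions is an open
condition. -/
lemma isOpen_le_card_filter_pos {X ι : Type*} [TopologicalSpace X] [Fintype ι]
    {f : X → ι → ℝ} (hf : ∀ i, Continuous fun x => f x i) (n : ℕ) :
    IsOpen {x | n ≤ (Finset.univ.filter fun i => 0 < f x i).card} := by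
  rw [isOpen_iff_mem_nhds]
  intro x hx
  have hev : ∀ᶠ z in nhds x, ∀ i, 0 < f x i → 0 < f z i := by
    rw [Filter.eventually_all]
    intro i
    by_cases hi : 0 < f x i
    · filter_upwards [(hf i).continuousAt.eventually (lt_mem_nhds hi)] with z hz _ using hz
    · exact Filter.Eventually.of_forall fun _ h => absurd h hi
  filter_upwards [hev] with z hz
  exact le_trans hx (Finset.card_le_card (Finset.monotone_filter_right _ fun i _ => hz i))

lemma isOpen_le_nPlus (n : ℕ) : IsOpen {y | n ≤ nPlus y} := by
  simp only [nPlus_eq_card]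
  exact isOpen_le_card_filter_pos continuous_facetVol n

lemma isOpen_le_nMinus (n : ℕ) : IsOpen {y | n ≤ nMinus y} := by
  simp only [nMinus_eq_card, ← neg_pos (a := facetVol _ _)]
  exact isOpen_le_card_filter_pos (fun i => (continuous_facetVol i).neg) n

lemma sum_facetVol (y : Fin 5 → EuclideanSpace ℝ (Fin 3)) : ∑ i, facetVol y i = 0 := by
  simp [facetVol, Fin.sum_univ_five, Matrix.det_fin_three, Fin.succAbove]
  ring

/-- The signed facet volumes are the coefficients of an affine dependence of the vertices. -/
lemma sum_facetVol_smul (y : Fin 5 → EuclideanSpace ℝ (Fin 3)) :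
    ∑ i, facetVol y i • y i = 0 := by
  ext a
  fin_cases a <;>
  · simp [facetVol, Fin.sum_univ_five, Matrix.det_fin_three, Fin.succAbove]
    ring

lemma collinear_of_weights {V : Type*} [AddCommGroup V] [Module ℝ V] {p q r : V} {a b c : ℝ}
    (ha : a ≠ 0) (hsum : a + b + c = 0) (h : a • p + b • q + c • r = 0) :
    Collinear ℝ ({p, q, r} : Set V) := by
  rw [collinear_iff_of_mem (p₀ := q) (by simp)]
  refine ⟨r - q, ?_⟩
  have hp : p = (-c / a) • (r - q) + q := by
    have hb : b = -a - c := by linarith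
    apply smul_right_injective V ha
    simp only [smul_add, smul_smul, mul_div_cancel₀ _ ha]
    rw [← sub_eq_zero, ← h, hb]
    module
  simp only [Set.mem_insert_iff, Set.mem_singleton_iff, vadd_eq_add]
  rintro x (rfl | rfl | rfl)
  · exact ⟨_, hp⟩
  · exact ⟨0, by simp⟩
  · exact ⟨1, by simp⟩

/-- A vector is in the span of two independent ones as soon as the three have vanishing
determinant. -/
lemma mem_span_pair_of_det_eq_zero {u v w : EuclideanSpace ℝ (Fin 3)}
    (huv : LinearIndependent ℝ ![u, v])
    (h : Matrix.det (Matrix.of fun a b : Fin 3 => (![u, v, w] b) a) = 0) :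
    w ∈ Submodule.span ℝ {u, v} := by
  by_contra hw
  have hli : LinearIndependent ℝ ![w, u, v] :=
    linearIndependent_finCons.2 ⟨huv, by simpa [Matrix.range_cons, Set.pair_comm] using hw⟩
  obtain ⟨g, hg, hg0⟩ := Matrix.exists_mulVec_eq_zero_iff.2 h
  rw [Fintype.linearIndependent_iff] at hli
  have key := hli ![g 2, g 0, g 1] (by
    ext a
    have := congrFun hg0 a
    simp [Matrix.mulVec, dotProduct, Fin.sum_univ_three] at this
    simp [Fin.sum_univ_three]
    linarith)
  apply hg
  ext i
  fin_cases i
  · exact key 1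
  · exact key 2
  · exact key 0

lemma MemA.exists_facetVol_ne_zero {y : Fin 5 → EuclideanSpace ℝ (Fin 3)} (hy : MemA y) :
    ∃ i, facetVol y i ≠ 0 := by
  by_contra! hall
  apply hy.1
  have hncol := hy.2 0 1 2 (by decide) (by decide) (by decide)
  have hli : LinearIndependent ℝ ![y 1 - y 0, y 2 - y 0] := by
    rw [LinearIndependent.pair_iff]
    intro s t hst
    by_contra hne
    apply hncol
    by_cases hs : s = 0
    · have ht : t ≠ 0 := fun ht => hne ⟨hs, ht⟩
      have := collinear_of_weights (p := y 2) (q := y 0) (r := y 1) (b := -t - s) (c := s) ht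
        (by ring) (by rw [← hst]; module)
      rwa [Set.insert_comm, Set.pair_comm] at this
    · have := collinear_of_weights (p := y 1) (q := y 0) (r := y 2) (b := -t - s) (c := t) hs
        (by ring) (by rw [← hst]; module)
      rwa [Set.insert_comm] at this
  have h3 : y 3 - y 0 ∈ Submodule.span ℝ {y 1 - y 0, y 2 - y 0} := by
    apply mem_span_pair_of_det_eq_zero hli
    have := hall 4
    simp [facetVol, Matrix.det_fin_three, Fin.succAbove] at this
    simp [Matrix.det_fin_three]
    linarith
  have h4 : y 4 - y 0 ∈ Submodule.span ℝ {y 1 - y 0, y 2 - y 0} := by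
    apply mem_span_pair_of_det_eq_zero hli
    have := hall 3
    simp [facetVol, Matrix.det_fin_three, Fin.succAbove] at this
    simp [Matrix.det_fin_three]
    linarith
  have hle : vectorSpan ℝ (Set.range y) ≤ Submodule.span ℝ {y 1 - y 0, y 2 - y 0} := by
    rw [vectorSpan_range_eq_span_range_vsub_right ℝ y 0, Submodule.span_le]
    rintro _ ⟨i, rfl⟩
    simp only [vsub_eq_sub]
    fin_cases i
    · simp
    · exact Submodule.subset_span (by simp)
    · exact Submodule.subset_span (by simp)
    · exact h3
    · exact h4
  exact (Submodule.rank_mono hle).trans ((rank_span_le _).trans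
    ((Cardinal.mk_insert_le).trans (by norm_num [one_add_one_eq_two])))

lemma Fin.exists_univ_eq_of_ne : ∀ i j k : Fin 5, i ≠ j → i ≠ k → j ≠ k →
    ∃ l m : Fin 5, k ≠ l ∧ l ≠ m ∧ k ≠ m ∧ [i, j, k, l, m].Nodup ∧
      (Finset.univ : Finset (Fin 5)) = [i, j, k, l, m].toFinset := by
  decide

/-- At most one facet of a member of `𝒜` is degenerate. -/
lemma MemA.eq_of_facetVol_eq_zero {y : Fin 5 → EuclideanSpace ℝ (Fin 3)} (hy : MemA y)
    {i j : Fin 5} (hi : facetVol y i = 0) (hj : facetVol y j = 0) : i = j := by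
  by_contra hij
  obtain ⟨k, hk⟩ := hy.exists_facetVol_ne_zero
  have hik : i ≠ k := by rintro rfl; exact hk hi
  have hjk : j ≠ k := by rintro rfl; exact hk hj
  obtain ⟨l, m, hkl, hlm, hkm, hnd, huniv⟩ := Fin.exists_univ_eq_of_ne i j k hij hik hjk
  have hsum := sum_facetVol y
  have hdep := sum_facetVol_smul y
  rw [huniv, List.sum_toFinset _ hnd] at hsum hdep
  simp only [List.map_cons, List.map_nil, List.sum_cons, List.sum_nil, hi, hj, zero_smul,
    zero_add, add_zero, ← add_assoc] at hsum hdep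
  exact hy.2 k l m hkl hlm hkm (collinear_of_weights hk hsum hdep)

lemma MemA.four_le_nMinus_add_nPlus {y : Fin 5 → EuclideanSpace ℝ (Fin 3)} (hy : MemA y) :
    4 ≤ nMinus y + nPlus y := by
  have hzero : (Finset.univ.filter fun i => facetVol y i = 0).card ≤ 1 := by
    rw [Finset.card_le_one]
    intro i hi j hj
    exact hy.eq_of_facetVol_eq_zero (Finset.mem_filter.1 hi).2 (Finset.mem_filter.1 hj).2
  have hcover : (Finset.univ : Finset (Fin 5)) ⊆
      ((Finset.univ.filter fun i => facetVol y i < 0) ∪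
        Finset.univ.filter fun i => 0 < facetVol y i) ∪
        Finset.univ.filter fun i => facetVol y i = 0 := by
    intro i _
    simp only [Finset.mem_union, Finset.mem_filter, Finset.mem_univ, true_and]
    rcases lt_trichotomy (facetVol y i) 0 with h | h | h <;> tauto
  have hcard := (Finset.card_le_card hcover).trans (Finset.card_union_le _ _)
  have hcard' := Finset.card_union_le (Finset.univ.filter fun i => facetVol y i < 0)
    (Finset.univ.filter fun i => 0 < facetVol y i)
  rw [Finset.card_univ, Fintype.card_fin] at hcard
  rw [nMinus_eq_card, nPlus_eq_card]
  omega

lemma nMinus_add_nPlus_le_five (y : Fin 5 → EuclideanSpace ℝ (Fin 3)) :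
    nMinus y + nPlus y ≤ 5 := by
  rw [nMinus_eq_card, nPlus_eq_card, ← Finset.card_union_of_disjoint]
  · exact (Finset.card_le_univ _).trans (by simp)
  · rw [Finset.disjoint_filter]
    exact fun i _ h => h.not_gt

/-- If `Q` is a connected subset of `𝒜` that does not intersect `𝒜₀` (i.e. `m ≠ 0`
on `Q`), then either `Q ⊆ 𝒜₊` (`m > 0` on `Q`) or `Q ⊆ 𝒜₋` (`m < 0` on `Q`). -/
theorem connected_avoiding_A0_has_constant_sign
    (Q : Set (Fin 5 → EuclideanSpace ℝ (Fin 3)))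
    (hQA : ∀ y ∈ Q, MemA y)
    (hconn : IsConnected Q)
    (h0 : ∀ y ∈ Q, mVal y ≠ 0) :
    (∀ y ∈ Q, 0 < mVal y) ∨ (∀ y ∈ Q, mVal y < 0) := by
  have hcover : Q ⊆ {y | 3 ≤ nMinus y} ∪ {y | 3 ≤ nPlus y} := by
    intro y hy
    have h4 := (hQA y hy).four_le_nMinus_add_nPlus
    have hm := h0 y hy
    simp only [mVal] at hm
    simp only [Set.mem_union, Set.mem_ofPred_eq]
    omega
  have hdisj : Disjoint {y | 3 ≤ nMinus y} {y | 3 ≤ nPlus y} := by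
    rw [Set.disjoint_left]
    intro y hy hy'
    have h5 := nMinus_add_nPlus_le_five y
    simp only [Set.mem_ofPred_eq] at hy hy'
    omega
  refine (hconn.isPreconnected.subset_or_subset (isOpen_le_nMinus 3) (isOpen_le_nPlus 3)
    hdisj hcover).imp (fun h y hy => ?_) (fun h y hy => ?_) <;>
  · have h3 := h hy
    have h5 := nMinus_add_nPlus_le_five y
    simp only [Set.mem_ofPred_eq] at h3
    simp only [mVal]
    omega
end

section
/- For every array (y₁,…,y₅) ∈ 𝒜 one has n₊ ≥ 1, n₋ ≥ 1, and n₀ ≤ 1; that is, at least one facet is positively oriented, at least one is negatively oriented, and at most one is degenerate. -/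
/-- The signed determinant whose sign is the orientation sign of the `i`-th facet. -/
noncomputable def facetDet (y : Fin 5 → EuclideanSpace ℝ (Fin 3)) (i : Fin 5) : ℝ :=
  (-1 : ℝ) ^ ((i : ℕ) + 1) *
    Matrix.det (Matrix.of fun a b : Fin 3 =>
      (y (Fin.succAbove i b.succ) - y (Fin.succAbove i 0)) a)

theorem facetSign_eq_sign (y : Fin 5 → EuclideanSpace ℝ (Fin 3)) (i : Fin 5) :
    facetSign y i = Real.sign (facetDet y i) := rfl

theorem facetSign_eq_zero_iff {y : Fin 5 → EuclideanSpace ℝ (Fin 3)} {i : Fin 5} :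
    facetSign y i = 0 ↔ facetDet y i = 0 := by
  rw [facetSign_eq_sign, Real.sign_eq_zero_iff]

theorem sum_facetDet (y : Fin 5 → EuclideanSpace ℝ (Fin 3)) : ∑ i, facetDet y i = 0 := by
  have h (i : Fin 5) : facetDet y i = (-1 : ℝ) ^ ((i : ℕ) + 1) *
      Matrix.det (Matrix.of fun a b : Fin 3 =>
        y (Fin.succAbove i b.succ) a - y (Fin.succAbove i 0) a) := rfl
  simp only [h, Fin.sum_univ_five, Matrix.det_fin_three, Matrix.of_apply]
  simp [Fin.succAbove, Fin.lt_def]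
  ring

/-- A set orthogonal to `m` linearly independent directions has codimension at least `m`. -/
theorem finrank_vectorSpan_add_le {E : Type*} [NormedAddCommGroup E] [InnerProductSpace ℝ E]
    [FiniteDimensional ℝ E] {m : ℕ} {v : Fin m → E} (hv : LinearIndependent ℝ v) {s : Set E}
    (h : ∀ i, ∀ p ∈ s, ∀ q ∈ s, inner ℝ (v i) (p - q) = 0) :
    m + Module.finrank ℝ (vectorSpan ℝ s) ≤ Module.finrank ℝ E := by
  have hle : vectorSpan ℝ s ≤ (Submodule.span ℝ (Set.range v))ᗮ := by
    rw [vectorSpan_def, Submodule.span_le]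
    rintro _ ⟨p, hp, q, hq, rfl⟩
    rw [SetLike.mem_coe, Submodule.mem_orthogonal]
    intro u hu
    induction hu using Submodule.span_induction with
    | mem x hx =>
      obtain ⟨i, rfl⟩ := hx
      exact h i p hp q hq
    | zero => simp
    | add a b _ _ ha hb => rw [inner_add_left, ha, hb, add_zero]
    | smul t a _ ha => rw [real_inner_smul_left, ha, mul_zero]
  have hadd := Submodule.finrank_add_finrank_orthogonal (Submodule.span ℝ (Set.range v))
  rw [finrank_span_eq_card hv, Fintype.card_fin] at hadd
  have := Submodule.finrank_mono hle
  omega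

/-- The vertices of a degenerate facet lie in a plane. -/
theorem exists_normal_of_facetDet_eq_zero {y : Fin 5 → EuclideanSpace ℝ (Fin 3)} {i : Fin 5}
    (h : facetDet y i = 0) :
    ∃ v : EuclideanSpace ℝ (Fin 3), v ≠ 0 ∧
      ∀ k l, k ≠ i → l ≠ i → inner ℝ v (y k - y l) = 0 := by
  have hdet := (mul_eq_zero.mp h).resolve_left (by positivity)
  obtain ⟨v, hv, hM⟩ := Matrix.exists_vecMul_eq_zero_iff.mpr hdet
  have key (b : Fin 4) :
      inner ℝ (WithLp.toLp 2 v) (y (i.succAbove b) - y (i.succAbove 0)) = 0 := by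
    induction b using Fin.cases with
    | zero => simp
    | succ b =>
      have := congrFun hM b
      simpa [Matrix.vecMul, dotProduct, PiLp.inner_apply, mul_comm] using this
  refine ⟨WithLp.toLp 2 v, by simpa using hv, fun k l hk hl => ?_⟩
  obtain ⟨k, rfl⟩ := Fin.exists_succAbove_eq hk
  obtain ⟨l, rfl⟩ := Fin.exists_succAbove_eq hl
  rw [← sub_sub_sub_cancel_right _ _ (y (i.succAbove 0)), inner_sub_right, key, key, sub_zero]

/-- Two distinct facets of an array in `𝒜` are not both degenerate. -/
theorem MemA.eq_of_facetDet_eq_zero {y : Fin 5 → EuclideanSpace ℝ (Fin 3)} (hy : MemA y)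
    {i j : Fin 5} (hi : facetDet y i = 0) (hj : facetDet y j = 0) : i = j := by
  by_contra hij
  obtain ⟨v, hv0, hv⟩ := exists_normal_of_facetDet_eq_zero hi
  obtain ⟨w, hw0, hw⟩ := exists_normal_of_facetDet_eq_zero hj
  have hthree : ∀ i j : Fin 5, ∃ a b c : Fin 5, (a ≠ b ∧ b ≠ c ∧ a ≠ c) ∧
      (a ≠ i ∧ b ≠ i ∧ c ≠ i) ∧ a ≠ j ∧ b ≠ j ∧ c ≠ j := by decide
  obtain ⟨a, b, c, ⟨hab, hbc, hac⟩, ⟨hai, hbi, hci⟩, haj, hbj, hcj⟩ := hthree i j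
  by_cases hli : LinearIndependent ℝ ![v, w]
  · refine hy.2 a b c hab hbc hac ?_
    rw [collinear_iff_finrank_le_one]
    have := finrank_vectorSpan_add_le hli (s := {y a, y b, y c}) (by
      intro m p hp q hq
      obtain ⟨k, hki, hkj, rfl⟩ : ∃ k, k ≠ i ∧ k ≠ j ∧ y k = p := by
        rcases hp with rfl | rfl | rfl
        exacts [⟨a, hai, haj, rfl⟩, ⟨b, hbi, hbj, rfl⟩, ⟨c, hci, hcj, rfl⟩]
      obtain ⟨l, hli, hlj, rfl⟩ : ∃ l, l ≠ i ∧ l ≠ j ∧ y l = q := by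
        rcases hq with rfl | rfl | rfl
        exacts [⟨a, hai, haj, rfl⟩, ⟨b, hbi, hbj, rfl⟩, ⟨c, hci, hcj, rfl⟩]
      fin_cases m
      exacts [hv k l hki hli, hw k l hkj hlj])
    rw [finrank_euclideanSpace_fin] at this
    omega
  · rw [LinearIndependent.pair_iff' hv0] at hli
    push Not at hli
    obtain ⟨t, rfl⟩ := hli
    have ht : t ≠ 0 := fun h => hw0 (by rw [h, zero_smul])
    have hv' (k : Fin 5) : inner ℝ v (y k - y a) = 0 := by
      by_cases hk : k = i
      · have := hw k a (hk ▸ hij) haj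
        rw [real_inner_smul_left] at this
        exact (mul_eq_zero.mp this).resolve_left ht
      · exact hv k a hk hai
    refine hy.1 ?_
    rw [coplanar_iff_finrank_le_two]
    have := finrank_vectorSpan_add_le (v := ![v]) (s := Set.range y)
      (by simpa [linearIndependent_unique_iff] using hv0) (by
        rintro m _ ⟨k, rfl⟩ _ ⟨l, rfl⟩
        fin_cases m
        rw [← sub_sub_sub_cancel_right _ _ (y a), inner_sub_right]
        simp [hv'])
    rw [finrank_euclideanSpace_fin] at this
    omega

theorem MemA.exists_facetDet_pos {y : Fin 5 → EuclideanSpace ℝ (Fin 3)} (hy : MemA y) :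
    ∃ i, 0 < facetDet y i := by
  by_contra! h
  have h0 := (Finset.sum_eq_zero_iff_of_nonpos fun i _ => h i).mp (sum_facetDet y)
  exact absurd (hy.eq_of_facetDet_eq_zero (h0 0 (Finset.mem_univ _)) (h0 1 (Finset.mem_univ _)))
    (by decide)

theorem MemA.exists_facetDet_neg {y : Fin 5 → EuclideanSpace ℝ (Fin 3)} (hy : MemA y) :
    ∃ i, facetDet y i < 0 := by
  by_contra! h
  have h0 := (Finset.sum_eq_zero_iff_of_nonneg fun i _ => h i).mp (sum_facetDet y)
  exact absurd (hy.eq_of_facetDet_eq_zero (h0 0 (Finset.mem_univ _)) (h0 1 (Finset.mem_univ _)))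
    (by decide)

/-- For every array in `𝒜` one has `n₊ ≥ 1`, `n₋ ≥ 1`, and `n₀ ≤ 1`: at least one
facet is positively oriented, at least one is negatively oriented, and at most one is
degenerate. -/
theorem facet_sign_counts (y : Fin 5 → EuclideanSpace ℝ (Fin 3)) (hy : MemA y) :
    1 ≤ nPlus y ∧ 1 ≤ nMinus y ∧ nZero y ≤ 1 := by
  refine ⟨?_, ?_, ?_⟩
  · obtain ⟨i, hi⟩ := hy.exists_facetDet_pos
    exact Finite.card_pos_iff.mpr ⟨⟨i, Real.sign_of_pos hi⟩⟩
  · obtain ⟨i, hi⟩ := hy.exists_facetDet_neg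
    exact Finite.card_pos_iff.mpr ⟨⟨i, Real.sign_of_neg hi⟩⟩
  · refine Finite.card_le_one_iff_subsingleton.mpr ⟨fun i j => Subtype.ext ?_⟩
    exact hy.eq_of_facetDet_eq_zero (facetSign_eq_zero_iff.mp i.2) (facetSign_eq_zero_iff.mp j.2)
end

section
/- Let (y₁,…,y₅) ∈ 𝒜 and let i ≠ j be two indices. Let Π be the affine plane through the three points y_k with k ∉ {i, j} (these three points are affinely independent, so Π is well defined). Suppose neither yᵢ nor yⱼ lies on Π. Then σᵢ = σⱼ if and only if yᵢ and yⱼ lie strictly on opposite sides of Π, and σᵢ = −σⱼ if and only if yᵢ and yⱼ lie strictly on the same side of Π. -/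
/-- The determinant of three vectors of `ℝ³`, written as rows. -/
noncomputable def rowDet (w u v : EuclideanSpace ℝ (Fin 3)) : ℝ :=
  Matrix.det (Matrix.of ![w.ofLp, u.ofLp, v.ofLp])

theorem rowDet_eq (w u v : EuclideanSpace ℝ (Fin 3)) :
    rowDet w u v = w 0 * u 1 * v 2 - w 0 * u 2 * v 1 - w 1 * u 0 * v 2
      + w 1 * u 2 * v 0 + w 2 * u 0 * v 1 - w 2 * u 1 * v 0 := by
  simp [rowDet, Matrix.det_fin_three]

theorem linearIndependent_sub_of_not_collinear {V : Type*} [AddCommGroup V] [Module ℝ V]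
    {a b c : V} (h : ¬ Collinear ℝ ({a, b, c} : Set V)) :
    LinearIndependent ℝ ![b - a, c - a] := by
  have hab : b - a ≠ 0 := by
    intro hab
    rw [sub_eq_zero] at hab
    subst hab
    exact h (by simpa using collinear_pair ℝ b c)
  rw [LinearIndependent.pair_iff' hab]
  intro t ht
  refine h ((collinear_iff_of_mem (p₀ := a) (by simp)).2 ⟨b - a, ?_⟩)
  rintro p (rfl | rfl | rfl)
  · exact ⟨0, by simp⟩
  · exact ⟨1, by simp⟩
  · exact ⟨t, by simp [ht]⟩

theorem mem_span_of_rowDet_eq_zero {w u v : EuclideanSpace ℝ (Fin 3)}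
    (huv : LinearIndependent ℝ ![u, v]) (h : rowDet w u v = 0) :
    w ∈ Submodule.span ℝ (Set.range ![u, v]) := by
  by_contra hw
  have hli : LinearIndependent ℝ ![w, u, v] := linearIndependent_finCons.2 ⟨huv, hw⟩
  have hli' := hli.map' (WithLp.linearEquiv 2 ℝ (Fin 3 → ℝ)).toLinearMap (LinearEquiv.ker _)
  have hrows : LinearIndependent ℝ (Matrix.of ![w.ofLp, u.ofLp, v.ofLp]).row := by
    have hcomp : (Matrix.of ![w.ofLp, u.ofLp, v.ofLp]).row =
        (WithLp.linearEquiv 2 ℝ (Fin 3 → ℝ)).toLinearMap ∘ ![w, u, v] := by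
      ext i k
      fin_cases i <;> rfl
    rw [hcomp]
    exact hli'
  rw [Matrix.linearIndependent_rows_iff_isUnit, Matrix.isUnit_iff_isUnit_det] at hrows
  exact hrows.ne_zero h

theorem vadd_mem_affineSpan_of_rowDet_eq_zero {a b c w : EuclideanSpace ℝ (Fin 3)}
    (habc : ¬ Collinear ℝ ({a, b, c} : Set (EuclideanSpace ℝ (Fin 3))))
    (h : rowDet w (b - a) (c - a) = 0) : w + a ∈ affineSpan ℝ {a, b, c} := by
  have ha : a ∈ affineSpan ℝ {a, b, c} := mem_affineSpan ℝ (by simp)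
  refine AffineSubspace.vadd_mem_of_mem_direction (v := w) ?_ ha
  refine Submodule.span_le.2 ?_
    (mem_span_of_rowDet_eq_zero (linearIndependent_sub_of_not_collinear habc) h)
  rintro _ ⟨i, rfl⟩
  fin_cases i
  · exact AffineSubspace.vsub_mem_direction (mem_affineSpan ℝ (by simp)) ha
  · exact AffineSubspace.vsub_mem_direction (mem_affineSpan ℝ (by simp)) ha

theorem rowDet_ne_zero_of_notMem_affineSpan {a b c p : EuclideanSpace ℝ (Fin 3)}
    (habc : ¬ Collinear ℝ ({a, b, c} : Set (EuclideanSpace ℝ (Fin 3))))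
    (hp : p ∉ affineSpan ℝ {a, b, c}) : rowDet (p - a) (b - a) (c - a) ≠ 0 := fun h =>
  hp (by simpa using vadd_mem_affineSpan_of_rowDet_eq_zero habc h)

theorem exists_eq_smul_vsub_vadd {a b c p q : EuclideanSpace ℝ (Fin 3)}
    (habc : ¬ Collinear ℝ ({a, b, c} : Set (EuclideanSpace ℝ (Fin 3))))
    (hp : p ∉ affineSpan ℝ {a, b, c}) :
    ∃ r ∈ affineSpan ℝ {a, b, c}, q =
      (rowDet (q - a) (b - a) (c - a) / rowDet (p - a) (b - a) (c - a)) • (p -ᵥ a) +ᵥ r := by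
  have hp0 := rowDet_ne_zero_of_notMem_affineSpan habc hp
  set t := rowDet (q - a) (b - a) (c - a) / rowDet (p - a) (b - a) (c - a) with ht
  refine ⟨(q - a - t • (p - a)) + a, vadd_mem_affineSpan_of_rowDet_eq_zero habc ?_, ?_⟩
  · have hlin : rowDet (q - a - t • (p - a)) (b - a) (c - a) =
        rowDet (q - a) (b - a) (c - a) - t * rowDet (p - a) (b - a) (c - a) := by
      simp only [rowDet_eq, PiLp.sub_apply, PiLp.smul_apply, smul_eq_mul]
      ring
    rw [hlin, ht, div_mul_cancel₀ _ hp0, sub_self]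
  · simp only [vsub_eq_sub, vadd_eq_add]
    abel

theorem sSameSide_affineSpan_of_rowDet {a b c p q : EuclideanSpace ℝ (Fin 3)}
    (habc : ¬ Collinear ℝ ({a, b, c} : Set (EuclideanSpace ℝ (Fin 3))))
    (hp : p ∉ affineSpan ℝ {a, b, c})
    (h : 0 < rowDet (q - a) (b - a) (c - a) / rowDet (p - a) (b - a) (c - a)) :
    (affineSpan ℝ {a, b, c}).SSameSide p q := by
  obtain ⟨r, hr, hq⟩ := exists_eq_smul_vsub_vadd (q := q) habc hp
  rw [hq]
  exact AffineSubspace.sSameSide_smul_vsub_vadd_right hp (mem_affineSpan ℝ (by simp)) hr h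

theorem sOppSide_affineSpan_of_rowDet {a b c p q : EuclideanSpace ℝ (Fin 3)}
    (habc : ¬ Collinear ℝ ({a, b, c} : Set (EuclideanSpace ℝ (Fin 3))))
    (hp : p ∉ affineSpan ℝ {a, b, c})
    (h : rowDet (q - a) (b - a) (c - a) / rowDet (p - a) (b - a) (c - a) < 0) :
    (affineSpan ℝ {a, b, c}).SOppSide p q := by
  obtain ⟨r, hr, hq⟩ := exists_eq_smul_vsub_vadd (q := q) habc hp
  rw [hq]
  exact AffineSubspace.sOppSide_smul_vsub_vadd_right hp (mem_affineSpan ℝ (by simp)) hr h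

theorem sign_mul_of_pos_left {t : ℝ} (ht : 0 < t) (x : ℝ) : Real.sign (t * x) = Real.sign x := by
  rcases lt_trichotomy x 0 with hx | rfl | hx
  · rw [Real.sign_of_neg hx, Real.sign_of_neg (mul_neg_of_pos_of_neg ht hx)]
  · rw [mul_zero]
  · rw [Real.sign_of_pos hx, Real.sign_of_pos (mul_pos ht hx)]

theorem det_eq_neg_one_pow_mul_rowDet (z : Fin 4 → EuclideanSpace ℝ (Fin 3)) (j : Fin 4) :
    Matrix.det (Matrix.of fun a b : Fin 3 => (z b.succ - z 0) a) =
      (-1) ^ ((j : ℕ) + 1) * rowDet (z j - z (j.succAbove 0))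
        (z (j.succAbove 1) - z (j.succAbove 0)) (z (j.succAbove 2) - z (j.succAbove 0)) := by
  rw [rowDet_eq, Matrix.det_fin_three]
  simp only [Matrix.of_apply, PiLp.sub_apply]
  fin_cases j <;> simp [Fin.succAbove, Fin.lt_def] <;> ring

/-- The sign of a facet, in terms of the position of the `j`-th of its vertices relative to the
other three. -/
theorem facetSign_eq_sign_rowDet (y : Fin 5 → EuclideanSpace ℝ (Fin 3)) (i : Fin 5) (j : Fin 4) :
    facetSign y i = Real.sign ((-1) ^ ((i : ℕ) + (j : ℕ)) *
      rowDet (y (i.succAbove j) - y (i.succAbove (j.succAbove 0)))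
        (y (i.succAbove (j.succAbove 1)) - y (i.succAbove (j.succAbove 0)))
        (y (i.succAbove (j.succAbove 2)) - y (i.succAbove (j.succAbove 0)))) := by
  have h := det_eq_neg_one_pow_mul_rowDet (fun n => y (i.succAbove n)) j
  unfold facetSign
  rw [h]
  congr 1
  ring

/-- The signs of two facets, in terms of the positions of the two opposite vertices relative to
the three common ones. -/
theorem exists_facetSign_eq (y : Fin 5 → EuclideanSpace ℝ (Fin 3)) {i j : Fin 5} (hij : i ≠ j) :
    ∃ k l m : Fin 5, k ≠ l ∧ l ≠ m ∧ k ≠ m ∧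
      ({n | n ≠ i ∧ n ≠ j} : Set (Fin 5)) = {k, l, m} ∧
      ∃ s : ℝ, s ≠ 0 ∧
        facetSign y i = Real.sign (s * rowDet (y j - y k) (y l - y k) (y m - y k)) ∧
        facetSign y j = Real.sign (-s * rowDet (y i - y k) (y l - y k) (y m - y k)) := by
  obtain ⟨j, rfl⟩ := Fin.exists_succAbove_eq hij.symm
  refine ⟨i.succAbove (j.succAbove 0), i.succAbove (j.succAbove 1), i.succAbove (j.succAbove 2),
    by simp, by simp, by simp, ?_, (-1) ^ ((i : ℕ) + (j : ℕ)), by simp,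
    facetSign_eq_sign_rowDet y i j, ?_⟩
  · ext n
    simp only [Set.mem_ofPred_eq, Set.mem_insert_iff, Set.mem_singleton_iff]
    clear hij
    revert i j n
    decide
  · have hi : (i.succAbove j).succAbove (j.predAbove i) = i := by
      clear hij
      revert i j
      decide
    have hrest : ∀ t : Fin 3, (i.succAbove j).succAbove ((j.predAbove i).succAbove t) =
        i.succAbove (j.succAbove t) := by
      clear hij hi
      revert i j
      decide
    have hparity : (i.succAbove j : ℕ) + (j.predAbove i : ℕ) = (i : ℕ) + (j : ℕ) + 1 ∨
        (i : ℕ) + (j : ℕ) = (i.succAbove j : ℕ) + (j.predAbove i : ℕ) + 1 := by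
      clear hij hi hrest
      revert i j
      decide
    have hpow : (-1 : ℝ) ^ ((i.succAbove j : ℕ) + (j.predAbove i : ℕ)) =
        -(-1) ^ ((i : ℕ) + (j : ℕ)) := by
      rcases hparity with h | h <;> rw [h, pow_succ] <;> ring
    rw [facetSign_eq_sign_rowDet y (i.succAbove j) (j.predAbove i), hpow, hi, hrest, hrest, hrest]

/-- Let `(y₁,…,y₅) ∈ 𝒜` and `i ≠ j`.  Let `Pl` be the affine plane spanned by the
three points `y k`, `k ∉ {i, j}`, and suppose neither `yᵢ` nor `yⱼ` lies on `Pl`.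
Then `σᵢ = σⱼ` iff `yᵢ` and `yⱼ` lie strictly on opposite sides of `Pl`, and
`σᵢ = −σⱼ` iff they lie strictly on the same side of `Pl`. -/
theorem facet_signs_and_sides (y : Fin 5 → EuclideanSpace ℝ (Fin 3)) (hy : MemA y)
    (i j : Fin 5) (hij : i ≠ j)
    (Pl : AffineSubspace ℝ (EuclideanSpace ℝ (Fin 3)))
    (hPl : Pl = affineSpan ℝ (y '' {k | k ≠ i ∧ k ≠ j}))
    (hi : y i ∉ Pl) (hj : y j ∉ Pl) :
    (facetSign y i = facetSign y j ↔ Pl.SOppSide (y i) (y j)) ∧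
      (facetSign y i = -facetSign y j ↔ Pl.SSameSide (y i) (y j)) := by
  obtain ⟨k, l, m, hkl, hlm, hkm, hset, s, hs, hsi, hsj⟩ := exists_facetSign_eq y hij
  have habc := hy.2 k l m hkl hlm hkm
  rw [hset, Set.image_insert_eq, Set.image_pair] at hPl
  subst hPl
  have hi0 := rowDet_ne_zero_of_notMem_affineSpan habc hi
  have hj0 := rowDet_ne_zero_of_notMem_affineSpan habc hj
  have hopp := sOppSide_affineSpan_of_rowDet (q := y j) habc hi
  have hsame := sSameSide_affineSpan_of_rowDet (q := y j) habc hi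
  have hexcl := fun h : (affineSpan ℝ {y k, y l, y m}).SOppSide (y i) (y j) => h.not_sSameSide
  rw [hsi, hsj]
  generalize rowDet (y i - y k) (y l - y k) (y m - y k) = A at *
  generalize rowDet (y j - y k) (y l - y k) (y m - y k) = B at *
  have hne : ∀ x : ℝ, x ≠ 0 → Real.sign x ≠ -Real.sign x := fun x hx h =>
    hx (Real.sign_eq_zero_iff.1 (self_eq_neg.1 h))
  have hB : s * B = (B / A) * (s * A) := by field_simp
  have hsA := hne (s * A) (mul_ne_zero hs hi0)
  rw [hB, neg_mul, Real.sign_neg, neg_neg]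
  rcases lt_or_gt_of_ne (div_ne_zero hj0 hi0) with h | h
  · have hsign : Real.sign (B / A * (s * A)) = -Real.sign (s * A) := by
      rw [← neg_neg (B / A), neg_mul, Real.sign_neg, sign_mul_of_pos_left (neg_pos.2 h)]
    rw [hsign]
    exact ⟨iff_of_true rfl (hopp h), iff_of_false hsA.symm (hexcl (hopp h))⟩
  · rw [sign_mul_of_pos_left h]
    exact ⟨iff_of_false hsA fun h' => hexcl h' (hsame h), iff_of_true rfl (hsame h)⟩
end

section
/- Let y₁,…,y₅ be five points in the plane ℝ² such that no three of them are collinear. Then there exist four indices i₁, i₂, i₃, i₄ such that the four points y_{i₁}, y_{i₂}, y_{i₃}, y_{i₄} are in convex position; that is, none of these four points lies in the convex hull of the other three. -/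
/-- Twice the signed area of the triangle with vertices `p`, `q`, `r`. -/
def signedArea (p q r : EuclideanSpace ℝ (Fin 2)) : ℝ :=
  (q 0 - p 0) * (r 1 - p 1) - (q 1 - p 1) * (r 0 - p 0)

theorem collinear_of_signedArea_eq_zero {p q r : EuclideanSpace ℝ (Fin 2)}
    (h : signedArea p q r = 0) : Collinear ℝ ({p, q, r} : Set (EuclideanSpace ℝ (Fin 2))) := by
  unfold signedArea at h
  by_cases hpq : q = p
  · subst hpq
    simpa using collinear_pair ℝ q r
  rw [collinear_iff_of_mem (p₀ := p) (by simp)]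
  refine ⟨q - p, ?_⟩
  have key : ∃ t : ℝ, r = t • (q - p) + p := by
    by_cases h0 : q 0 - p 0 = 0
    · have h1 : q 1 - p 1 ≠ 0 := by
        intro h1
        apply hpq
        ext i
        fin_cases i
        · exact sub_eq_zero.mp h0
        · exact sub_eq_zero.mp h1
      refine ⟨(r 1 - p 1) / (q 1 - p 1), ?_⟩
      ext i
      fin_cases i
      · have : r 0 - p 0 = 0 := by simpa [h0, h1] using h
        simp [h0]
        linarith
      · simp
        field_simp
        ring
    · refine ⟨(r 0 - p 0) / (q 0 - p 0), ?_⟩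
      ext i
      fin_cases i
      · simp
        field_simp
        ring
      · simp
        field_simp
        linarith
  rintro x (rfl | rfl | rfl)
  · exact ⟨0, by simp⟩
  · exact ⟨1, by simp⟩
  · simpa using key

/-- The product of the signed areas of the four triangles spanned by four points. It is positive
for points in convex position and negative if one point is interior to the triangle spanned by
the others. -/
def areaProduct (p q r s : EuclideanSpace ℝ (Fin 2)) : ℝ :=
  signedArea q r s * signedArea p r s * signedArea p q s * signedArea p q r

theorem areaProduct_nonpos_of_mem_convexHull {p a b c : EuclideanSpace ℝ (Fin 2)}
    (h : p ∈ convexHull ℝ ({a, b, c} : Set (EuclideanSpace ℝ (Fin 2)))) :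
    areaProduct p a b c ≤ 0 := by
  rw [convexHull_insert (by simp), convexHull_pair] at h
  simp only [mem_convexJoin, Set.mem_singleton_iff, exists_eq_left] at h
  obtain ⟨m, ⟨u, v, hu, hv, huv, rfl⟩, s, t, hs, ht, hst, rfl⟩ := h
  obtain rfl : u = 1 - v := by linarith
  obtain rfl : s = 1 - t := by linarith
  have : areaProduct ((1 - t) • a + t • ((1 - v) • b + v • c)) a b c =
      -((1 - t) * (t * (1 - v)) * (t * v) * signedArea a b c ^ 4) := by
    simp [areaProduct, signedArea]
    ring
  rw [this, neg_nonpos]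
  positivity

theorem areaProduct_nonpos_of_exists_mem_convexHull {z : Fin 4 → EuclideanSpace ℝ (Fin 2)}
    (h : ∃ a, z a ∈ convexHull ℝ (z '' {b | b ≠ a})) :
    areaProduct (z 0) (z 1) (z 2) (z 3) ≤ 0 := by
  obtain ⟨a, ha⟩ := h
  have reorder : ∀ i j k : Fin 4, ({b | b ≠ a} : Set (Fin 4)) = {i, j, k} →
      areaProduct (z a) (z i) (z j) (z k) ≤ 0 := by
    intro i j k hijk
    apply areaProduct_nonpos_of_mem_convexHull
    rwa [hijk, Set.image_insert_eq, Set.image_pair] at ha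
  fin_cases a
  · exact reorder 1 2 3 (by ext b; fin_cases b <;> simp)
  · convert reorder 0 2 3 (by ext b; fin_cases b <;> simp) using 1
    simp [areaProduct, signedArea]
    ring
  · convert reorder 0 1 3 (by ext b; fin_cases b <;> simp) using 1
    simp [areaProduct, signedArea]
    ring
  · convert reorder 0 1 2 (by ext b; fin_cases b <;> simp) using 1
    simp [areaProduct, signedArea]
    ring

/-- Among any five points in the plane, no three of which are collinear, there are four
points in convex position: none of the four lies in the convex hull of the other three. -/
theorem four_points_in_convex_position (y : Fin 5 → EuclideanSpace ℝ (Fin 2))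
    (hgen : ∀ i j k : Fin 5, i ≠ j → j ≠ k → i ≠ k →
      ¬ Collinear ℝ ({y i, y j, y k} : Set (EuclideanSpace ℝ (Fin 2)))) :
    ∃ f : Fin 4 → Fin 5, Function.Injective f ∧
      ∀ a : Fin 4, y (f a) ∉ convexHull ℝ ((fun b => y (f b)) '' {b | b ≠ a}) := by
  by_contra! hcon
  have area_ne (i j k : Fin 5) (hij : i ≠ j) (hjk : j ≠ k) (hik : i ≠ k) :
      signedArea (y i) (y j) (y k) ≠ 0 :=
    fun h => hgen i j k hij hjk hik (collinear_of_signedArea_eq_zero h)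
  have product_neg (i j k l : Fin 5) (hij : i ≠ j) (hik : i ≠ k) (hil : i ≠ l) (hjk : j ≠ k)
      (hjl : j ≠ l) (hkl : k ≠ l) : areaProduct (y i) (y j) (y k) (y l) < 0 := by
    refine lt_of_le_of_ne ?_ ?_
    · refine areaProduct_nonpos_of_exists_mem_convexHull (z := fun b => y (![i, j, k, l] b))
        (hcon ![i, j, k, l] ?_)
      intro a b hab
      fin_cases a <;> fin_cases b <;> simp_all
    · simp [areaProduct, *]
  have h0 := product_neg 1 2 3 4 (by decide) (by decide) (by decide) (by decide) (by decide)
    (by decide)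
  have h1 := product_neg 0 2 3 4 (by decide) (by decide) (by decide) (by decide) (by decide)
    (by decide)
  have h2 := product_neg 0 1 3 4 (by decide) (by decide) (by decide) (by decide) (by decide)
    (by decide)
  have h3 := product_neg 0 1 2 4 (by decide) (by decide) (by decide) (by decide) (by decide)
    (by decide)
  have h4 := product_neg 0 1 2 3 (by decide) (by decide) (by decide) (by decide) (by decide)
    (by decide)
  have hneg := mul_neg_of_pos_of_neg
    (mul_pos (mul_pos_of_neg_of_neg h0 h1) (mul_pos_of_neg_of_neg h2 h3)) h4
  -- Each of the ten triangles belongs to exactly two of the five quadruples.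
  have hsq := sq_nonneg (signedArea (y 0) (y 1) (y 2) * signedArea (y 0) (y 1) (y 3) *
    signedArea (y 0) (y 1) (y 4) * signedArea (y 0) (y 2) (y 3) * signedArea (y 0) (y 2) (y 4) *
    signedArea (y 0) (y 3) (y 4) * signedArea (y 1) (y 2) (y 3) * signedArea (y 1) (y 2) (y 4) *
    signedArea (y 1) (y 3) (y 4) * signedArea (y 2) (y 3) (y 4))
  refine absurd hneg (not_lt.mpr (hsq.trans_eq ?_))
  unfold areaProduct
  ring
end

section
/- Let B be a symmetric bilinear form on a real vector space V, let p, q ∈ V, and let u, v ∈ V satisfy B(u,u) = 0 and B(v,v) = 0 (u and v are lightlike). Suppose that B(w,w) ≥ 0 for every vector w of the form (p + s·u) − (q + t·v) with s, t ≥ 0 (the union of the two half-lines {p + s·u : s ≥ 0} and {q + t·v : t ≥ 0} is spacelike). Then the function (s,t) ↦ √(B(w,w)) with w = (p + s·u) − (q + t·v) is nondecreasing in s and nondecreasing in t on [0,∞) × [0,∞). -/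
/-- A bilinear form that is nonnegative along a half-line with lightlike direction is
nondecreasing along it. -/
theorem LinearMap.BilinForm.apply_add_smul_le_of_lightlike {V : Type*} [AddCommGroup V]
    [Module ℝ V] (B : LinearMap.BilinForm ℝ V) (x w : V) (hw : B w w = 0)
    (hnonneg : ∀ s : ℝ, 0 ≤ s → 0 ≤ B (x + s • w) (x + s • w))
    {s₁ s₂ : ℝ} (h : s₁ ≤ s₂) :
    B (x + s₁ • w) (x + s₁ • w) ≤ B (x + s₂ • w) (x + s₂ • w) := by
  have affine (s : ℝ) : B (x + s • w) (x + s • w) = B x x + s * (B x w + B w x) := by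
    simp only [map_add, map_smul, LinearMap.add_apply, LinearMap.smul_apply, smul_eq_mul, hw]
    ring
  have slope_nonneg : 0 ≤ B x w + B w x := by
    by_contra! hneg
    have hx : 0 ≤ B x x := by simpa using hnonneg 0 le_rfl
    have hs := hnonneg ((B x x + 1) / -(B x w + B w x))
      (div_nonneg (by linarith) (by linarith))
    rw [affine, div_neg, neg_mul, div_mul_cancel₀ _ hneg.ne] at hs
    linarith
  rw [affine, affine]
  gcongr

/-- Sublemma: let `B` be a symmetric bilinear form on a real vector space, and let `u`,
`v` be lightlike vectors (`B u u = 0`, `B v v = 0`).  If the union of the half-lines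
`s ↦ p + s • u` and `t ↦ q + t • v` (for `s, t ≥ 0`) is spacelike, then
`(s, t) ↦ √(B w w)` with `w = (p + s • u) - (q + t • v)` is nondecreasing in each
argument on `[0, ∞) × [0, ∞)`. -/
theorem dist_between_lightlike_halflines_monotone {V : Type*} [AddCommGroup V]
    [Module ℝ V] (B : LinearMap.BilinForm ℝ V)
    (hsymm : ∀ x y : V, B x y = B y x)
    (p q u v : V) (hu : B u u = 0) (hv : B v v = 0)
    (hspacelike : ∀ s t : ℝ, 0 ≤ s → 0 ≤ t →
      0 ≤ B ((p + s • u) - (q + t • v)) ((p + s • u) - (q + t • v))) :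
    (∀ s₁ s₂ t : ℝ, 0 ≤ s₁ → s₁ ≤ s₂ → 0 ≤ t →
      Real.sqrt (B ((p + s₁ • u) - (q + t • v)) ((p + s₁ • u) - (q + t • v))) ≤
        Real.sqrt (B ((p + s₂ • u) - (q + t • v)) ((p + s₂ • u) - (q + t • v)))) ∧
    (∀ s t₁ t₂ : ℝ, 0 ≤ s → 0 ≤ t₁ → t₁ ≤ t₂ →
      Real.sqrt (B ((p + s • u) - (q + t₁ • v)) ((p + s • u) - (q + t₁ • v))) ≤
        Real.sqrt (B ((p + s • u) - (q + t₂ • v)) ((p + s • u) - (q + t₂ • v)))) := by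
  refine ⟨fun s₁ s₂ t _ h ht ↦ Real.sqrt_le_sqrt ?_, fun s t₁ t₂ hs _ h ↦ Real.sqrt_le_sqrt ?_⟩
  · have decomp (s : ℝ) : (p + s • u) - (q + t • v) = (p - (q + t • v)) + s • u := by abel
    rw [decomp, decomp]
    refine B.apply_add_smul_le_of_lightlike _ u hu (fun s hs ↦ ?_) h
    rw [← decomp]
    exact hspacelike s t hs ht
  · have decomp (t : ℝ) : (p + s • u) - (q + t • v) = (p + s • u - q) + t • (-v) := by
      rw [smul_neg]
      abel
    rw [decomp, decomp]
    refine B.apply_add_smul_le_of_lightlike _ (-v) (by simp [hv]) (fun t ht ↦ ?_) h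
    rw [← decomp]
    exact hspacelike s t hs ht
end
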